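/- arXiv:2405.09268 — 8 statements merged into one kernel-verified Lean document; each statement's English description precedes it below -/
import Mathlib

section
/- Let α > 0, and set a₀ = ((3α³ + 22α² + 48α + 32)/(2(α² + 4α + 8)²))^{1/α}, b₀ = α/(2√(α² + 4α + 8)), and ω₀ = 4(α² + 4α + 4)/(α⁴ + 8α³ + 32α² + 64α + 64). Then the function φ : ℝ → ℝ defined by φ(x) = a₀ · (sech(b₀ x))^{4/α} is smooth, strictly positive, even, and satisfies the fourth-order ordinary differential equation φ''''(x) − φ''(x) + ω₀ φ(x) − φ(x)^{α+1} = 0 for every x ∈ ℝ. -/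
open Real MeasureTheory

theorem hasDerivAt_cosh_mul_rpow (b q x : ℝ) :
    HasDerivAt (fun x => Real.cosh (b * x) ^ q)
      (b * q * Real.sinh (b * x) * Real.cosh (b * x) ^ (q - 1)) x := by
  have h : HasDerivAt (fun x => Real.cosh (b * x)) (Real.sinh (b * x) * (b * 1)) x :=
    ((hasDerivAt_id x).const_mul b).cosh
  convert h.rpow_const (p := q) (Or.inl (Real.cosh_pos _).ne') using 1
  ring

theorem hasDerivAt_deriv_cosh_mul_rpow (b q x : ℝ) :
    HasDerivAt (fun x => b * q * Real.sinh (b * x) * Real.cosh (b * x) ^ (q - 1))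
      (b ^ 2 * (q ^ 2 * Real.cosh (b * x) ^ q
        - q * (q - 1) * Real.cosh (b * x) ^ (q - 2))) x := by
  have h : HasDerivAt (fun x => Real.sinh (b * x)) (Real.cosh (b * x) * (b * 1)) x :=
    ((hasDerivAt_id x).const_mul b).sinh
  refine ((h.const_mul (b * q)).mul (hasDerivAt_cosh_mul_rpow b (q - 1) x)).congr_deriv ?_
  have hc := Real.cosh_pos (b * x)
  have h1 : Real.cosh (b * x) ^ (q - 1)
      = Real.cosh (b * x) ^ (q - 2) * Real.cosh (b * x) := by
    rw [← Real.rpow_add_one hc.ne']; ring_nf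
  have h2 : Real.cosh (b * x) ^ q
      = Real.cosh (b * x) ^ (q - 2) * Real.cosh (b * x) ^ 2 := by
    rw [← Real.rpow_add_natCast hc.ne']; norm_num
  rw [show q - 1 - 1 = q - 2 by ring, h1, h2]
  linear_combination (-b ^ 2 * q * (q - 1) * Real.cosh (b * x) ^ (q - 2))
    * Real.cosh_sq (b * x)

theorem deriv_deriv_const_mul_cosh_mul_rpow (A b q : ℝ) :
    deriv (deriv fun x => A * Real.cosh (b * x) ^ q) = fun x =>
      A * (b ^ 2 * (q ^ 2 * Real.cosh (b * x) ^ q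
        - q * (q - 1) * Real.cosh (b * x) ^ (q - 2))) := by
  have h : (deriv fun x => A * Real.cosh (b * x) ^ q) = fun x =>
      A * (b * q * Real.sinh (b * x) * Real.cosh (b * x) ^ (q - 1)) :=
    funext fun x => ((hasDerivAt_cosh_mul_rpow b q x).const_mul A).deriv
  rw [h]
  exact funext fun x => ((hasDerivAt_deriv_cosh_mul_rpow b q x).const_mul A).deriv

theorem contDiff_const_mul_cosh_mul_rpow (A b q : ℝ) {n : WithTop ℕ∞} :
    ContDiff ℝ n fun x => A * Real.cosh (b * x) ^ q :=
  contDiff_const.mul <|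
    (Real.contDiff_cosh.comp (contDiff_const.mul contDiff_id)).rpow_const_of_ne
      fun _ => (Real.cosh_pos _).ne'

theorem deriv_four_const_mul_cosh_mul_rpow (A b q : ℝ) :
    deriv (deriv (deriv (deriv fun x => A * Real.cosh (b * x) ^ q))) = fun x =>
      A * b ^ 4 * (q ^ 4 * Real.cosh (b * x) ^ q
        - q * (q - 1) * (q ^ 2 + (q - 2) ^ 2) * Real.cosh (b * x) ^ (q - 2)
        + q * (q - 1) * (q - 2) * (q - 3) * Real.cosh (b * x) ^ (q - 4)) := by
  have hd : ∀ B r : ℝ, Differentiable ℝ fun x => B * Real.cosh (b * x) ^ r := fun B r =>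
    (contDiff_const_mul_cosh_mul_rpow B b r (n := 1)).differentiable one_ne_zero
  have hd' : ∀ B r : ℝ, Differentiable ℝ (deriv fun x => B * Real.cosh (b * x) ^ r) :=
    fun B r => ((contDiff_const_mul_cosh_mul_rpow B b r (n := 2)).differentiable_deriv_two)
  have hsplit : (fun x => A * (b ^ 2 * (q ^ 2 * Real.cosh (b * x) ^ q
        - q * (q - 1) * Real.cosh (b * x) ^ (q - 2)))) =
      (fun x => (A * b ^ 2 * q ^ 2) * Real.cosh (b * x) ^ q)
        + fun x => (-(A * b ^ 2 * q * (q - 1))) * Real.cosh (b * x) ^ (q - 2) := by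
    funext x
    simp only [Pi.add_apply]
    ring
  have hadd : ∀ f g : ℝ → ℝ, Differentiable ℝ f → Differentiable ℝ g →
      deriv (f + g) = deriv f + deriv g := fun f g hf hg =>
    funext fun x => deriv_add (hf x) (hg x)
  rw [deriv_deriv_const_mul_cosh_mul_rpow, hsplit, hadd _ _ (hd _ _) (hd _ _),
    hadd _ _ (hd' _ _) (hd' _ _), deriv_deriv_const_mul_cosh_mul_rpow,
    deriv_deriv_const_mul_cosh_mul_rpow]
  funext x
  simp only [Pi.add_apply]
  rw [show q - 2 - 2 = q - 4 by ring]
  ring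

/-- The explicit solitary wave `φ(x) = a₀ sech^{4/α}(b₀ x)` of the fourth-order NLS
is smooth, positive, even, and solves `φ'''' - φ'' + ω₀ φ - φ^{α+1} = 0`. -/
theorem explicit_solitary_wave_solves_4NLS (α : ℝ) (hα : 0 < α)
    (a₀ b₀ ω₀ : ℝ)
    (ha : a₀ = ((3*α^3 + 22*α^2 + 48*α + 32) / (2*(α^2 + 4*α + 8)^2)) ^ (1/α))
    (hb : b₀ = α / (2 * Real.sqrt (α^2 + 4*α + 8)))
    (hω : ω₀ = 4*(α^2 + 4*α + 4) / (α^4 + 8*α^3 + 32*α^2 + 64*α + 64))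
    (φ : ℝ → ℝ)
    (hφ : ∀ x, φ x = a₀ * (Real.cosh (b₀ * x))⁻¹ ^ ((4:ℝ)/α)) :
    ContDiff ℝ (⊤ : ℕ∞) φ ∧ (∀ x, 0 < φ x) ∧ (∀ x, φ (-x) = φ x) ∧
    ∀ x, iteratedDeriv 4 φ x - iteratedDeriv 2 φ x + ω₀ * φ x - φ x ^ (α + 1) = 0 := by
  have hφ' : φ = fun x => a₀ * Real.cosh (b₀ * x) ^ (-(4 / α)) := by
    funext x
    rw [hφ, Real.inv_rpow (Real.cosh_pos _).le, Real.rpow_neg (Real.cosh_pos _).le]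
  have ha0 : 0 < a₀ := by rw [ha]; positivity
  have hpos : ∀ x, 0 < φ x := fun x => by
    rw [hφ]
    have := Real.cosh_pos (b₀ * x)
    positivity
  refine ⟨?_, hpos, fun x => ?_, fun x => ?_⟩
  · rw [hφ']
    exact contDiff_const_mul_cosh_mul_rpow _ _ _
  · rw [hφ, hφ, mul_neg, Real.cosh_neg]
  have hc := Real.cosh_pos (b₀ * x)
  have hD : 0 < α ^ 2 + 4 * α + 8 := by positivity
  have hb2 : b₀ ^ 2 = α ^ 2 / (4 * (α ^ 2 + 4 * α + 8)) := by
    rw [hb, div_pow, mul_pow, Real.sq_sqrt hD.le]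
    norm_num
  have hb4 : b₀ ^ 4 = (α ^ 2 / (4 * (α ^ 2 + 4 * α + 8))) ^ 2 := by
    rw [← hb2]; ring
  have haα : a₀ ^ α = (3*α^3 + 22*α^2 + 48*α + 32) / (2*(α^2 + 4*α + 8)^2) := by
    rw [ha, ← Real.rpow_mul (by positivity), one_div_mul_cancel hα.ne', Real.rpow_one]
  have hω' : ω₀ = 4 * (α ^ 2 + 4 * α + 4) / (α ^ 2 + 4 * α + 8) ^ 2 := by
    rw [hω]; ring_nf
  have hpow : φ x ^ (α + 1)
      = a₀ * a₀ ^ α * Real.cosh (b₀ * x) ^ (-(4 / α) - 4) := by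
    rw [hφ', Real.mul_rpow ha0.le (by positivity), ← Real.rpow_mul hc.le,
      Real.rpow_add_one ha0.ne', mul_comm a₀]
    congr 2
    field_simp
    ring
  have h2 : iteratedDeriv 2 φ = deriv (deriv φ) := by
    simp only [iteratedDeriv_succ, iteratedDeriv_zero]
  have h4 : iteratedDeriv 4 φ = deriv (deriv (deriv (deriv φ))) := by
    simp only [iteratedDeriv_succ, iteratedDeriv_zero]
  rw [hpow, h2, h4, hφ', deriv_four_const_mul_cosh_mul_rpow,
    deriv_deriv_const_mul_cosh_mul_rpow]
  simp only [hb2, hb4, haα, hω']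
  generalize Real.cosh (b₀ * x) ^ (-(4 / α)) = u
  generalize Real.cosh (b₀ * x) ^ (-(4 / α) - 2) = v
  generalize Real.cosh (b₀ * x) ^ (-(4 / α) - 4) = w
  field_simp
  ring
end

section
/- Let α > 0 and ω > 0. If ψ : ℝ → ℝ is a twice continuously differentiable, strictly positive, even function with ψ(x) → 0 and ψ'(x) → 0 as |x| → ∞, satisfying −ψ''(x) + ω ψ(x) − ψ(x)^{α+1} = 0 for all x ∈ ℝ, then ψ(x) = (ω(α + 2)/2)^{1/α} · (sech(α√ω x / 2))^{2/α} for all x ∈ ℝ. -/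
open Real Filter

/-- A solution of `v'' = k² v` with `v'(0) = 0` is `v(0) cosh (k x)`. -/
theorem eq_mul_cosh_of_hasDerivAt {k : ℝ} (hk : k ≠ 0) {v w : ℝ → ℝ}
    (hv : ∀ x, HasDerivAt v (w x) x) (hw : ∀ x, HasDerivAt w (k ^ 2 * v x) x)
    (hw0 : w 0 = 0) (x : ℝ) : v x = v 0 * Real.cosh (k * x) := by
  have hlin (x : ℝ) : HasDerivAt (fun y => k * y) k x := by
    simpa using (hasDerivAt_id x).const_mul k
  have hA (x : ℝ) : HasDerivAt
      (fun y => k * (v y * Real.cosh (k * y)) - w y * Real.sinh (k * y)) 0 x := by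
    refine ((((hv x).mul (hlin x).cosh).const_mul k).sub
      ((hw x).mul (hlin x).sinh)).congr_deriv ?_
    ring
  have hB (x : ℝ) : HasDerivAt
      (fun y => k * (v y * Real.sinh (k * y)) - w y * Real.cosh (k * y)) 0 x := by
    refine ((((hv x).mul (hlin x).sinh).const_mul k).sub
      ((hw x).mul (hlin x).cosh)).congr_deriv ?_
    ring
  have hA0 := is_const_of_deriv_eq_zero (fun x => (hA x).differentiableAt)
    (fun x => (hA x).deriv) x 0
  have hB0 := is_const_of_deriv_eq_zero (fun x => (hB x).differentiableAt)
    (fun x => (hB x).deriv) x 0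
  simp [hw0] at hA0 hB0
  have hcs := Real.cosh_sq (k * x)
  apply mul_left_cancel₀ hk
  linear_combination Real.cosh (k * x) * hA0 - Real.sinh (k * x) * hB0 - k * v x * hcs

/-- The energy of a solution of the standing-wave equation that decays together with its
derivative vanishes identically. -/
theorem sq_eq_of_standing_wave_of_tendsto {α ω : ℝ} (hα : 0 < α) {ψ φ : ℝ → ℝ}
    (hpos : ∀ x, 0 < ψ x) (hψ : ∀ x, HasDerivAt ψ (φ x) x)
    (hφ : ∀ x, HasDerivAt φ (ω * ψ x - ψ x ^ (α + 1)) x)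
    (hdecay : Tendsto ψ (cocompact ℝ) (nhds 0))
    (hdecay' : Tendsto φ (cocompact ℝ) (nhds 0)) (x : ℝ) :
    φ x ^ 2 = ω * ψ x ^ 2 - 2 / (α + 2) * ψ x ^ (α + 2) := by
  have hα2 : α + 2 ≠ 0 := by positivity
  have hE (x : ℝ) : HasDerivAt
      (fun y => φ y ^ 2 - ω * ψ y ^ 2 + 2 / (α + 2) * ψ y ^ (α + 2)) 0 x := by
    refine ((((hφ x).pow 2).sub (((hψ x).pow 2).const_mul ω)).add
      (((hψ x).rpow_const (p := α + 2) (Or.inl (hpos x).ne')).const_mul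
        (2 / (α + 2)))).congr_deriv ?_
    rw [show α + 2 - 1 = α + 1 by ring]
    field_simp
    push_cast
    ring
  have hlim : Tendsto (fun y => φ y ^ 2 - ω * ψ y ^ 2 + 2 / (α + 2) * ψ y ^ (α + 2))
      (cocompact ℝ) (nhds 0) := by
    have h := ((hdecay'.pow 2).sub ((hdecay.pow 2).const_mul ω)).add
      ((hdecay.rpow_const (p := α + 2) (Or.inr (by positivity))).const_mul (2 / (α + 2)))
    simpa [Real.zero_rpow hα2] using h
  have hconst (y : ℝ) := is_const_of_deriv_eq_zero (fun x => (hE x).differentiableAt)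
    (fun x => (hE x).deriv) y x
  have h0 := tendsto_nhds_unique (tendsto_const_nhds.congr fun y => (hconst y).symm) hlim
  linear_combination h0

/-- Uniqueness of the positive, even, decaying solution of the NLS standing-wave
equation `-ψ'' + ωψ - ψ^{α+1} = 0`: it is the explicit hyperbolic-secant profile. -/
theorem NLS_positive_even_decaying_solution_unique (α ω : ℝ) (hα : 0 < α) (hω : 0 < ω)
    (ψ : ℝ → ℝ)
    (hreg : ContDiff ℝ 2 ψ)
    (hpos : ∀ x, 0 < ψ x)
    (heven : ∀ x, ψ (-x) = ψ x)
    (hdecay : Tendsto ψ (cocompact ℝ) (nhds 0))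
    (hdecay' : Tendsto (deriv ψ) (cocompact ℝ) (nhds 0))
    (heq : ∀ x, -(iteratedDeriv 2 ψ x) + ω * ψ x - ψ x ^ (α + 1) = 0) :
    ∀ x, ψ x = (ω*(α + 2)/2) ^ (1/α) *
      (Real.cosh (α * Real.sqrt ω * x / 2))⁻¹ ^ ((2:ℝ)/α) := by
  intro x
  have hα2 : α + 2 ≠ 0 := by positivity
  have hψ (x : ℝ) : HasDerivAt ψ (deriv ψ x) x :=
    (hreg.differentiable (by norm_num) x).hasDerivAt
  have hφ (x : ℝ) : HasDerivAt (deriv ψ) (ω * ψ x - ψ x ^ (α + 1)) x := by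
    have hd := hreg.differentiable_iteratedDeriv 1 (by norm_num) x
    rw [iteratedDeriv_one] at hd
    refine hd.hasDerivAt.congr_deriv ?_
    have h := heq x
    rw [iteratedDeriv_succ, iteratedDeriv_one] at h
    linear_combination -h
  have hen := sq_eq_of_standing_wave_of_tendsto hα hpos hψ hφ hdecay hdecay'
  have hφ0 : deriv ψ 0 = 0 := by
    have h := deriv_comp_neg ψ 0
    rw [funext heven, neg_zero] at h
    linarith
  have hpow (x : ℝ) : ψ x ^ (α + 2) = ψ x ^ α * ψ x ^ 2 := by
    rw [Real.rpow_add (hpos x), Real.rpow_two]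
  have hψ0 : ψ 0 ^ α = ω * (α + 2) / 2 := by
    have h := hen 0
    rw [hφ0, hpow] at h
    have h2 := pow_pos (hpos 0) 2
    apply mul_right_cancel₀ h2.ne'
    field_simp at h ⊢
    linear_combination h
  have hv (x : ℝ) : HasDerivAt (fun y => ψ y ^ (-α / 2))
      (-α / 2 * (deriv ψ x * ψ x ^ (-α / 2 - 1))) x :=
    ((hψ x).rpow_const (Or.inl (hpos x).ne')).congr_deriv (by ring)
  have hw (x : ℝ) : HasDerivAt (fun y => -α / 2 * (deriv ψ y * ψ y ^ (-α / 2 - 1)))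
      ((α * √ω / 2) ^ 2 * ψ x ^ (-α / 2)) x := by
    refine (((hφ x).mul ((hψ x).rpow_const (p := -α / 2 - 1)
      (Or.inl (hpos x).ne'))).const_mul (-α / 2)).congr_deriv ?_
    have hp := (hpos x).ne'
    have h := hen x
    rw [hpow] at h
    rw [Real.rpow_sub_one hp (-α / 2 - 1), Real.rpow_sub_one hp (-α / 2),
      Real.rpow_add_one hp, div_pow, mul_pow, Real.sq_sqrt hω.le]
    generalize ψ x ^ (-α / 2) = q
    field_simp at h ⊢
    linear_combination q * h
  have hk : α * √ω / 2 ≠ 0 := by positivity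
  have hsol := eq_mul_cosh_of_hasDerivAt hk hv hw (by simp [hφ0]) x
  have hroot (p : ℝ) (hp : 0 < p) : p = (p ^ (-α / 2)) ^ (-(2 / α)) := by
    rw [← Real.rpow_mul hp.le]
    field_simp
    simp
  have hcosh := Real.cosh_pos (α * √ω / 2 * x)
  rw [show α * √ω * x / 2 = α * √ω / 2 * x by ring, hroot _ (hpos x), hsol,
    Real.mul_rpow (Real.rpow_nonneg (hpos 0).le _) hcosh.le, ← hroot _ (hpos 0), ← hψ0,
    one_div, Real.rpow_rpow_inv (hpos 0).le hα.ne', Real.inv_rpow hcosh.le,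
    Real.rpow_neg hcosh.le]
end

section
/- Let α > 0 and for ω > 0 let φ_ω(x) = (ω(α + 2)/2)^{1/α} · (sech(α√ω x / 2))^{2/α}. Then for every ω > 0 the function ω ↦ (1/2)∫_ℝ φ_ω(x)² dx is differentiable, and its derivative equals (1/(2ω)) · ((4 − α)/(2α)) · ∫_ℝ φ_ω(x)² dx. In particular this derivative is positive when 0 < α < 4 and negative when α > 4. -/
open Real MeasureTheory

/-- The explicit NLS solitary-wave profile. -/
noncomputable def nlsProfile (α ω x : ℝ) : ℝ :=
  (ω*(α + 2)/2) ^ (1/α) * (Real.cosh (α * Real.sqrt ω * x / 2))⁻¹ ^ ((2:ℝ)/α)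

lemma nlsProfile_pos {α ω : ℝ} (hα : 0 < α) (hω : 0 < ω) (x : ℝ) : 0 < nlsProfile α ω x := by
  have := Real.cosh_pos (α * Real.sqrt ω * x / 2)
  unfold nlsProfile
  positivity

lemma continuous_nlsProfile {α : ℝ} (hα : 0 < α) (ω : ℝ) : Continuous (nlsProfile α ω) := by
  unfold nlsProfile
  refine continuous_const.mul (Continuous.rpow_const ?_ fun x => Or.inr (by positivity))
  exact (by fun_prop : Continuous fun x => Real.cosh (α * Real.sqrt ω * x / 2)).inv₀
    fun x => (Real.cosh_pos _).ne'

/-- The scaling relation reducing every frequency to `ω = 1`. -/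
lemma nlsProfile_eq_rpow_mul {α ω : ℝ} (hα : 0 < α) (hω : 0 < ω) (x : ℝ) :
    nlsProfile α ω x = ω ^ (1/α) * nlsProfile α 1 (√ω * x) := by
  unfold nlsProfile
  rw [show ω * (α + 2) / 2 = ω * (1 * (α + 2) / 2) by ring,
    Real.mul_rpow hω.le (by positivity), Real.sqrt_one, mul_one, mul_assoc, mul_assoc α]

lemma inv_cosh_rpow_le {p : ℝ} (hp : 0 ≤ p) (y : ℝ) :
    (Real.cosh y)⁻¹ ^ p ≤ 2 ^ p * Real.exp (-(p * y)) := by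
  have h : (Real.cosh y)⁻¹ ≤ 2 * Real.exp (-y) := by
    rw [Real.exp_neg, ← inv_inv (2 : ℝ), ← mul_inv]
    refine inv_anti₀ (by positivity) ?_
    rw [Real.cosh_eq]
    linarith [Real.exp_pos (-y)]
  calc (Real.cosh y)⁻¹ ^ p ≤ (2 * Real.exp (-y)) ^ p :=
        Real.rpow_le_rpow (inv_nonneg.2 (Real.cosh_pos y).le) h hp
    _ = 2 ^ p * Real.exp (-(p * y)) := by
        rw [Real.mul_rpow zero_le_two (Real.exp_pos _).le, ← Real.exp_mul]
        ring_nf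

lemma integrable_nlsProfile_one_sq {α : ℝ} (hα : 0 < α) :
    Integrable fun x : ℝ => (nlsProfile α 1 x) ^ 2 := by
  have hcont : Continuous fun x : ℝ => (nlsProfile α 1 x) ^ 2 :=
    (continuous_nlsProfile hα 1).pow 2
  have hright : IntegrableOn (fun x : ℝ => (nlsProfile α 1 x) ^ 2) (Set.Ioi 0) := by
    refine integrable_of_isBigO_exp_neg two_pos hcont.continuousOn
      (Asymptotics.IsBigO.of_bound (((1*(α + 2)/2) ^ (1/α) * 2 ^ (2/α)) ^ 2)
        (Filter.Eventually.of_forall fun x => ?_))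
    have hbound : nlsProfile α 1 x ≤ (1*(α + 2)/2) ^ (1/α) * 2 ^ (2/α) * Real.exp (-x) := by
      have := inv_cosh_rpow_le (p := 2/α) (by positivity) (α * √1 * x / 2)
      rw [show 2 / α * (α * √1 * x / 2) = x by rw [Real.sqrt_one]; field_simp] at this
      unfold nlsProfile
      exact (mul_le_mul_of_nonneg_left this (by positivity)).trans_eq (mul_assoc _ _ _).symm
    rw [Real.norm_of_nonneg (sq_nonneg _), Real.norm_of_nonneg (Real.exp_pos _).le,
      show Real.exp (-2 * x) = Real.exp (-x) ^ 2 by rw [← Real.exp_nat_mul]; congr 1; push_cast; ring,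
      ← mul_pow]
    exact pow_le_pow_left₀ (nlsProfile_pos hα one_pos x).le hbound 2
  have hleft : IntegrableOn (fun x : ℝ => (nlsProfile α 1 x) ^ 2) (Set.Iic 0) := by
    have heven : (fun x : ℝ => (nlsProfile α 1 x) ^ 2) = fun x => (nlsProfile α 1 (-x)) ^ 2 := by
      funext x
      unfold nlsProfile
      rw [show α * √1 * -x / 2 = -(α * √1 * x / 2) by ring, Real.cosh_neg]
    rw [integrableOn_Iic_iff_integrableOn_Iio, heven]
    exact IntegrableOn.comp_neg_Iio (c := (0 : ℝ)) (f := fun x => (nlsProfile α 1 x) ^ 2)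
      (by rwa [neg_zero])
  rw [← integrableOn_univ, ← Set.Iic_union_Ioi (a := (0 : ℝ))]
  exact hleft.union hright

lemma integral_nlsProfile_one_sq_pos {α : ℝ} (hα : 0 < α) :
    0 < ∫ x : ℝ, (nlsProfile α 1 x) ^ 2 :=
  integral_pos_of_integrable_nonneg_nonzero (x := 0) ((continuous_nlsProfile hα 1).pow 2)
    (integrable_nlsProfile_one_sq hα) (fun _ => sq_nonneg _)
    (pow_pos (nlsProfile_pos hα one_pos 0) 2).ne'

lemma integral_nlsProfile_sq {α ω : ℝ} (hα : 0 < α) (hω : 0 < ω) :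
    ∫ x : ℝ, (nlsProfile α ω x) ^ 2 =
      ω ^ (2/α - 1/2) * ∫ x : ℝ, (nlsProfile α 1 x) ^ 2 := by
  have hpow : (ω ^ (1/α)) ^ 2 * (√ω)⁻¹ = ω ^ (2/α - 1/2) := by
    rw [Real.rpow_sub hω, ← Real.sqrt_eq_rpow, ← Real.rpow_mul_natCast hω.le, div_eq_mul_inv]
    congr 2
    push_cast
    ring
  simp_rw [nlsProfile_eq_rpow_mul hα hω, mul_pow]
  rw [integral_const_mul, Measure.integral_comp_mul_left (fun y => (nlsProfile α 1 y) ^ 2),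
    abs_of_pos (inv_pos.2 (Real.sqrt_pos.2 hω)), smul_eq_mul, ← mul_assoc, hpow]

/-- `d''(ω)` for the classical NLS: the map `ω ↦ (1/2)∫ φ_ω²` is differentiable with
derivative `(1/(2ω))((4-α)/(2α))∫ φ_ω²`, positive for `0 < α < 4`, negative for `α > 4`. -/
theorem NLS_dprime_derivative (α : ℝ) (hα : 0 < α) :
    ∀ ω : ℝ, 0 < ω →
      HasDerivAt (fun w => (1/2) * ∫ x : ℝ, (nlsProfile α w x)^2)
        ((1/(2*ω)) * ((4 - α)/(2*α)) * ∫ x : ℝ, (nlsProfile α ω x)^2) ω ∧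
      (α < 4 → 0 < (1/(2*ω)) * ((4 - α)/(2*α)) * ∫ x : ℝ, (nlsProfile α ω x)^2) ∧
      (4 < α → (1/(2*ω)) * ((4 - α)/(2*α)) * ∫ x : ℝ, (nlsProfile α ω x)^2 < 0) := by
  intro ω hω
  have hpos : 0 < ∫ x : ℝ, (nlsProfile α ω x) ^ 2 := by
    rw [integral_nlsProfile_sq hα hω]
    exact mul_pos (Real.rpow_pos_of_pos hω _) (integral_nlsProfile_one_sq_pos hα)
  refine ⟨?_, fun h => ?_, fun h => ?_⟩
  · have hderiv := ((Real.hasDerivAt_rpow_const (p := 2/α - 1/2) (Or.inl hω.ne')).mul_const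
      (∫ x : ℝ, (nlsProfile α 1 x) ^ 2)).const_mul (1/2)
    refine (hderiv.congr_of_eventuallyEq ?_).congr_deriv ?_
    · filter_upwards [lt_mem_nhds hω] with w hw
      rw [integral_nlsProfile_sq hα hw]
    · rw [integral_nlsProfile_sq hα hω, Real.rpow_sub_one hω.ne']
      field_simp
      ring
  · have : 0 < 4 - α := sub_pos.2 h
    positivity
  · have : (4 - α) / (2 * α) < 0 := div_neg_of_neg_of_pos (sub_neg.2 h) (by positivity)
    exact mul_neg_of_neg_of_pos (mul_neg_of_pos_of_neg (by positivity) this) hpos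
end

section
/- Let s > 0 and b > 0. Then for every ξ ∈ ℝ one has ∫_ℝ (sech(b x))^s cos(ξ x) dx > 0. -/
open Real MeasureTheory

lemma abs_deriv_sigmoid_smul_betaIntegrand (u v : ℂ) (x : ℝ) :
    |sigmoid x * (1 - sigmoid x)| •
        ((sigmoid x : ℂ) ^ (u - 1) * (1 - (sigmoid x : ℂ)) ^ (v - 1)) =
      (sigmoid x : ℂ) ^ u * (sigmoid (-x) : ℂ) ^ v := by
  have hp := sigmoid_pos x
  have hq : 0 < 1 - sigmoid x := sub_pos.2 (sigmoid_lt_one x)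
  have hp' : (sigmoid x : ℂ) ≠ 0 := by exact_mod_cast hp.ne'
  have hq' : (1 - sigmoid x : ℂ) ≠ 0 := by exact_mod_cast hq.ne'
  rw [abs_of_pos (mul_pos hp hq), sigmoid_neg, Complex.real_smul]
  push_cast
  rw [Complex.cpow_sub _ _ hp', Complex.cpow_sub _ _ hq', Complex.cpow_one, Complex.cpow_one]
  field_simp

lemma integrable_sigmoid_cpow_mul {u v : ℂ} (hu : 0 < u.re) (hv : 0 < v.re) :
    Integrable fun x : ℝ => (sigmoid x : ℂ) ^ u * (sigmoid (-x) : ℂ) ^ v := by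
  have h := Complex.betaIntegral_convergent hu hv
  rw [intervalIntegrable_iff_integrableOn_Ioo_of_le zero_le_one, ← range_sigmoid,
    ← Set.image_univ, integrableOn_image_iff_integrableOn_abs_deriv_smul MeasurableSet.univ
      (fun x _ => (hasDerivAt_sigmoid x).hasDerivWithinAt) sigmoid_injective.injOn,
    integrableOn_univ] at h
  simpa only [abs_deriv_sigmoid_smul_betaIntegrand] using h

lemma integral_sigmoid_cpow_mul (u v : ℂ) :
    ∫ x : ℝ, (sigmoid x : ℂ) ^ u * (sigmoid (-x) : ℂ) ^ v = Complex.betaIntegral u v := by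
  rw [Complex.betaIntegral, intervalIntegral.integral_of_le zero_le_one,
    integral_Ioc_eq_integral_Ioo, ← range_sigmoid, ← Set.image_univ,
    integral_image_eq_integral_abs_deriv_smul MeasurableSet.univ
      (fun x _ => (hasDerivAt_sigmoid x).hasDerivWithinAt) sigmoid_injective.injOn,
    setIntegral_univ]
  simp only [abs_deriv_sigmoid_smul_betaIntegrand]

lemma log_sigmoid_two_mul (y : ℝ) : log (sigmoid (2 * y)) = y - log (2 * cosh y) := by
  have h : sigmoid (2 * y) = exp y / (2 * cosh y) := by
    rw [sigmoid_def, cosh_eq, inv_eq_one_div, div_eq_div_iff (by positivity) (by positivity)]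
    have : exp (-y) = exp y * exp (-(2 * y)) := by rw [← exp_add]; ring_nf
    rw [this]
    ring
  rw [h, log_div (exp_ne_zero y) (by positivity), log_exp]

lemma re_sigmoid_two_mul_cpow_mul (s η y : ℝ) :
    ((sigmoid (2 * y) : ℂ) ^ (s / 2 + η * Complex.I : ℂ) *
        (sigmoid (-(2 * y)) : ℂ) ^ (s / 2 - η * Complex.I : ℂ)).re =
      2⁻¹ ^ s * ((cosh y)⁻¹ ^ s * cos (2 * η * y)) := by
  have hp : (sigmoid (2 * y) : ℂ) ≠ 0 := by exact_mod_cast (sigmoid_pos _).ne'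
  have hq : (sigmoid (-(2 * y)) : ℂ) ≠ 0 := by exact_mod_cast (sigmoid_pos _).ne'
  have hc := cosh_pos y
  have hlog := log_sigmoid_two_mul (-y)
  rw [cosh_neg, mul_neg] at hlog
  rw [Complex.cpow_def_of_ne_zero hp, Complex.cpow_def_of_ne_zero hq, ← Complex.exp_add,
    ← Complex.ofReal_log (sigmoid_nonneg _), ← Complex.ofReal_log (sigmoid_nonneg _),
    log_sigmoid_two_mul, hlog, Complex.exp_re, ← mul_assoc,
    ← mul_rpow (by positivity) (by positivity), ← mul_inv, rpow_def_of_pos (by positivity),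
    log_inv]
  congr 2
  · simp
    ring
  · simp
    ring

lemma betaIntegral_conj_re_pos {u : ℂ} (hu : 0 < u.re) :
    0 < (Complex.betaIntegral u (starRingEnd ℂ u)).re := by
  have hG : Complex.Gamma u ≠ 0 := Complex.Gamma_ne_zero_of_re_pos hu
  rw [Complex.betaIntegral_eq_Gamma_mul_div _ _ hu (by simpa using hu), Complex.Gamma_conj,
    Complex.mul_conj, Complex.add_conj, Complex.Gamma_ofReal, ← Complex.ofReal_div,
    Complex.ofReal_re]
  exact div_pos (Complex.normSq_pos.2 hG) (Gamma_pos_of_pos (by positivity))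

/-- Strict positivity of the Fourier transform of powers of the hyperbolic secant. -/
theorem fourier_sech_pow_pos (s b : ℝ) (hs : 0 < s) (hb : 0 < b) :
    ∀ ξ : ℝ, 0 < ∫ x : ℝ, (Real.cosh (b * x))⁻¹ ^ s * Real.cos (ξ * x) := by
  intro ξ
  obtain ⟨η, hη⟩ : ∃ η : ℝ, 2 * η * b = ξ := ⟨ξ / (2 * b), by field_simp⟩
  set u : ℂ := s / 2 + η * Complex.I with hu_def
  have hconj : starRingEnd ℂ u = s / 2 - η * Complex.I := by
    simp [hu_def, sub_eq_add_neg, Complex.conj_ofNat]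
  have hu : 0 < u.re := by simpa [hu_def] using hs
  have hpos := betaIntegral_conj_re_pos hu
  rw [← integral_sigmoid_cpow_mul, ← RCLike.re_eq_complex_re,
    ← integral_re (integrable_sigmoid_cpow_mul hu (by simpa using hu))] at hpos
  have hscale := Measure.integral_comp_mul_left (fun x : ℝ => RCLike.re
    ((sigmoid x : ℂ) ^ u * (sigmoid (-x) : ℂ) ^ starRingEnd ℂ u)) (2 * b)
  have hfun : ∀ x : ℝ, RCLike.re ((sigmoid (2 * b * x) : ℂ) ^ u *
      (sigmoid (-(2 * b * x)) : ℂ) ^ starRingEnd ℂ u) =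
      2⁻¹ ^ s * ((cosh (b * x))⁻¹ ^ s * cos (ξ * x)) := by
    intro x
    rw [hconj, RCLike.re_eq_complex_re, mul_assoc 2 b x, re_sigmoid_two_mul_cpow_mul, ← mul_assoc (2 * η),
      hη]
  simp only [hfun] at hscale
  rw [integral_const_mul] at hscale
  refine pos_of_mul_pos_right (a := 2⁻¹ ^ s) ?_ (by positivity)
  rw [hscale, smul_eq_mul]
  exact mul_pos (by positivity) hpos
end

section
/- Let f : ℝ → ℝ be a strictly positive, twice differentiable function such that (log f)''(x) < 0 for all x ≠ 0. Then f belongs to the class PF(2); that is: (i) f(x) > 0 for all x; (ii) for all x₁ < x₂ and y₁ < y₂ one has f(x₁ − y₁) f(x₂ − y₂) − f(x₁ − y₂) f(x₂ − y₁) ≥ 0; and (iii) this inequality is strict whenever the open intervals (x₁, x₂) and (y₁, y₂) have nonempty intersection. -/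
open Real

theorem strictAnti_of_deriv_neg_of_ne {g : ℝ → ℝ} {c : ℝ} (hg : Continuous g)
    (hg' : ∀ x, x ≠ c → deriv g x < 0) : StrictAnti g := by
  refine StrictAntiOn.Iic_union_Ici (a := c) ?_ ?_
  · refine strictAntiOn_of_deriv_neg (convex_Iic c) hg.continuousOn fun x hx => hg' x ?_
    rw [interior_Iic] at hx
    exact ne_of_lt hx
  · refine strictAntiOn_of_deriv_neg (convex_Ici c) hg.continuousOn fun x hx => hg' x ?_
    rw [interior_Ici] at hx
    exact ne_of_gt hx

theorem StrictConcaveOn.add_lt_add_of_shift {g : ℝ → ℝ} (hg : StrictConcaveOn ℝ Set.univ g)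
    (b : ℝ) {s t : ℝ} (hs : 0 < s) (ht : 0 < t) :
    g b + g (b + s + t) < g (b + s) + g (b + t) := by
  have hst : 0 < s + t := by positivity
  have hne : b ≠ b + s + t := by linarith
  have hsum : s / (s + t) + t / (s + t) = 1 := by field_simp
  have h₁ := hg.2 (Set.mem_univ b) (Set.mem_univ (b + s + t)) hne
    (div_pos hs hst) (div_pos ht hst) hsum
  have h₂ := hg.2 (Set.mem_univ b) (Set.mem_univ (b + s + t)) hne
    (div_pos ht hst) (div_pos hs hst) (by rw [add_comm]; exact hsum)
  simp only [smul_eq_mul] at h₁ h₂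
  have e₁ : s / (s + t) * b + t / (s + t) * (b + s + t) = b + t := by field_simp; ring
  have e₂ : t / (s + t) * b + s / (s + t) * (b + s + t) = b + s := by field_simp; ring
  rw [e₁] at h₁
  rw [e₂] at h₂
  linear_combination h₁ + h₂ - (g b + g (b + s + t)) * hsum

theorem strictConcaveOn_log_comp {f : ℝ → ℝ} {c : ℝ} (hpos : ∀ x, 0 < f x)
    (hd1 : Differentiable ℝ f) (hd2 : Differentiable ℝ (deriv f))
    (hlog : ∀ x, x ≠ c → deriv (deriv fun y => Real.log (f y)) x < 0) :
    StrictConcaveOn ℝ Set.univ fun y => Real.log (f y) := by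
  have hderiv : (deriv fun y => Real.log (f y)) = fun x => deriv f x / f x :=
    funext fun x => deriv.log (hd1 x) (hpos x).ne'
  have hcont : Continuous (deriv fun y => Real.log (f y)) := by
    rw [hderiv]
    exact hd2.continuous.div hd1.continuous fun x => (hpos x).ne'
  exact (strictAnti_of_deriv_neg_of_ne hcont hlog).strictConcaveOn_univ_of_deriv
    (hd1.continuous.log fun x => (hpos x).ne')

/-- A positive, twice differentiable function with `(log f)'' < 0` away from `0`
belongs to the total-positivity class PF(2). -/
theorem log_concave_mem_PF2 (f : ℝ → ℝ)
    (hpos : ∀ x, 0 < f x)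
    (hd1 : Differentiable ℝ f)
    (hd2 : Differentiable ℝ (deriv f))
    (hlog : ∀ x : ℝ, x ≠ 0 → deriv (deriv (fun y => Real.log (f y))) x < 0) :
    (∀ x, 0 < f x) ∧
    (∀ x₁ x₂ y₁ y₂ : ℝ, x₁ < x₂ → y₁ < y₂ →
      0 ≤ f (x₁ - y₁) * f (x₂ - y₂) - f (x₁ - y₂) * f (x₂ - y₁)) ∧
    (∀ x₁ x₂ y₁ y₂ : ℝ, x₁ < x₂ → y₁ < y₂ →
      (Set.Ioo x₁ x₂ ∩ Set.Ioo y₁ y₂).Nonempty →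
      0 < f (x₁ - y₁) * f (x₂ - y₂) - f (x₁ - y₂) * f (x₂ - y₁)) := by
  have key : ∀ x₁ x₂ y₁ y₂ : ℝ, x₁ < x₂ → y₁ < y₂ →
      0 < f (x₁ - y₁) * f (x₂ - y₂) - f (x₁ - y₂) * f (x₂ - y₁) := by
    intro x₁ x₂ y₁ y₂ hx hy
    have h := (strictConcaveOn_log_comp hpos hd1 hd2 hlog).add_lt_add_of_shift (x₁ - y₂)
      (sub_pos.2 hx) (sub_pos.2 hy)
    rw [show x₁ - y₂ + (x₂ - x₁) + (y₂ - y₁) = x₂ - y₁ by ring,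
      show x₁ - y₂ + (x₂ - x₁) = x₂ - y₂ by ring,
      show x₁ - y₂ + (y₂ - y₁) = x₁ - y₁ by ring,
      ← Real.log_mul (hpos _).ne' (hpos _).ne', ← Real.log_mul (hpos _).ne' (hpos _).ne',
      Real.log_lt_log_iff (mul_pos (hpos _) (hpos _)) (mul_pos (hpos _) (hpos _))] at h
    linarith
  exact ⟨hpos, fun _ _ _ _ hx hy => (key _ _ _ _ hx hy).le,
    fun _ _ _ _ hx hy _ => key _ _ _ _ hx hy⟩
end

section
/- Let f, g : ℝ → ℝ be strictly positive, continuous, integrable functions that are log-concave, i.e., f(λx + (1−λ)y) ≥ f(x)^λ f(y)^{1−λ} and g(λx + (1−λ)y) ≥ g(x)^λ g(y)^{1−λ} for all x, y ∈ ℝ and λ ∈ [0,1]. Then the convolution h(x) = ∫_ℝ f(x − t) g(t) dt is strictly positive and log-concave: h(λx + (1−λ)y) ≥ h(x)^λ h(y)^{1−λ} for all x, y ∈ ℝ and λ ∈ [0,1]. -/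
open Real MeasureTheory

/-- A strictly positive integrable function on `ℝ` has strictly positive integral. -/
lemma integral_pos_of_forall_pos {F : ℝ → ℝ} (hpos : ∀ x, 0 < F x) (hi : Integrable F) :
    0 < ∫ x, F x := by
  rw [integral_pos_iff_support_of_nonneg (fun x => (hpos x).le) hi]
  have : Function.support F = Set.univ := Set.eq_univ_of_forall fun x => (hpos x).ne'
  simp [this]

/-- The quantile function of a strictly positive, continuous, integrable density is
differentiable on `(0, 1)`, with derivative the total mass divided by the density. -/
lemma exists_quantile_hasDerivAt {F : ℝ → ℝ} (hpos : ∀ x, 0 < F x) (hc : Continuous F)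
    (hi : Integrable F) :
    ∃ u : ℝ → ℝ, ∀ s ∈ Set.Ioo (0 : ℝ) 1, HasDerivAt u ((∫ x, F x) / F (u s)) s := by
  set A := ∫ x, F x with hA
  have hApos : 0 < A := integral_pos_of_forall_pos hpos hi
  set Φ : ℝ → ℝ := fun t => (∫ x in Set.Iic t, F x) / A with hΦ
  have hderiv (t : ℝ) : HasDerivAt Φ (F t / A) t := by
    have h := ((hc.integral_hasStrictDerivAt 0 t).hasDerivAt.const_add
      (∫ x in Set.Iic 0, F x)).div_const A
    refine h.congr_of_eventuallyEq (Filter.Eventually.of_forall fun r => ?_)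
    simp only [hΦ]
    rw [← intervalIntegral.integral_Iic_sub_Iic hi.integrableOn hi.integrableOn,
      add_sub_cancel]
  have hmono : StrictMono Φ :=
    strictMono_of_hasDerivAt_pos hderiv fun t => div_pos (hpos t) hApos
  have hcont : Continuous Φ := continuous_iff_continuousAt.2 fun t => (hderiv t).continuousAt
  have hbot : Filter.Tendsto Φ Filter.atBot (nhds 0) := by
    simpa using (tendsto_integral_Iic_zero (f := F) (μ := volume) Filter.tendsto_id).div_const A
  have htop : Filter.Tendsto Φ Filter.atTop (nhds 1) := by
    have h := ((aecover_Iic (μ := volume) (l := Filter.atTop) (b := fun t : ℝ => t)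
      Filter.tendsto_id).integral_tendsto_of_countably_generated hi).div_const A
    rwa [← hA, div_self hApos.ne'] at h
  have hmem (t : ℝ) : Φ t ∈ Set.Ioo (0 : ℝ) 1 :=
    ⟨(hmono.monotone.le_of_tendsto hbot (t - 1)).trans_lt (hmono (by linarith)),
      (hmono (by linarith)).trans_le (hmono.monotone.ge_of_tendsto htop (t + 1))⟩
  have hsurj (s : ℝ) : ∃ t, s ∈ Set.Ioo (0 : ℝ) 1 → Φ t = s := by
    by_cases hs : s ∈ Set.Ioo (0 : ℝ) 1
    · obtain ⟨t, ht⟩ := mem_range_of_exists_le_of_exists_ge hcont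
        ((hbot.eventually_le_const hs.1).exists) ((htop.eventually_const_le hs.2).exists)
      exact ⟨t, fun _ => ht⟩
    · exact ⟨0, fun h => absurd h hs⟩
  choose u hu using hsurj
  refine ⟨u, fun s hs => ?_⟩
  have hnhds : Set.Ioo (0 : ℝ) 1 ∈ nhds s := isOpen_Ioo.mem_nhds hs
  have humono : StrictMonoOn u (Set.Ioo 0 1) := fun a ha b hb hab =>
    hmono.lt_iff_lt.1 (by rwa [hu a ha, hu b hb])
  have himage : u '' Set.Ioo 0 1 = Set.univ :=
    Set.eq_univ_of_forall fun t => ⟨Φ t, hmem t, hmono.injective (hu _ (hmem t))⟩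
  have hucont : ContinuousAt u s :=
    humono.continuousAt_of_image_mem_nhds hnhds (himage ▸ Filter.univ_mem)
  have h := HasDerivAt.of_local_left_inverse hucont (hderiv (u s))
    (div_pos (hpos _) hApos).ne' (Filter.mem_of_superset hnhds hu)
  rwa [inv_div] at h

/-- The one-dimensional Prékopa–Leindler inequality for strictly positive, continuous,
integrable functions. -/
theorem prekopa_leindler_real {F G H : ℝ → ℝ} {l : ℝ} (hl0 : 0 ≤ l) (hl1 : l ≤ 1)
    (hF : ∀ x, 0 < F x) (hG : ∀ x, 0 < G x) (hH : ∀ x, 0 ≤ H x)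
    (hFc : Continuous F) (hGc : Continuous G)
    (hFi : Integrable F) (hGi : Integrable G) (hHi : Integrable H)
    (hFGH : ∀ x y, F x ^ l * G y ^ (1 - l) ≤ H (l * x + (1 - l) * y)) :
    (∫ x, F x) ^ l * (∫ x, G x) ^ (1 - l) ≤ ∫ x, H x := by
  obtain ⟨u, hu⟩ := exists_quantile_hasDerivAt hF hFc hFi
  obtain ⟨v, hv⟩ := exists_quantile_hasDerivAt hG hGc hGi
  have hA := integral_pos_of_forall_pos hF hFi
  have hB := integral_pos_of_forall_pos hG hGi
  set A := ∫ x, F x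
  set B := ∫ x, G x
  have hl1' : 0 ≤ 1 - l := sub_nonneg.2 hl1
  let z : ℝ → ℝ := fun s => l * u s + (1 - l) * v s
  let z' : ℝ → ℝ := fun s => l * (A / F (u s)) + (1 - l) * (B / G (v s))
  have hz : ∀ s ∈ Set.Ioo (0 : ℝ) 1, HasDerivAt z (z' s) s := fun s hs =>
    ((hu s hs).const_mul l).add ((hv s hs).const_mul (1 - l))
  have hamgm (s : ℝ) : (A / F (u s)) ^ l * (B / G (v s)) ^ (1 - l) ≤ z' s :=
    geom_mean_le_arith_mean2_weighted hl0 hl1' (div_pos hA (hF _)).le (div_pos hB (hG _)).le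
      (by ring)
  have hz'pos (s : ℝ) : 0 < z' s :=
    (mul_pos (rpow_pos_of_pos (div_pos hA (hF _)) _)
      (rpow_pos_of_pos (div_pos hB (hG _)) _)).trans_le (hamgm s)
  have hzmono : StrictMonoOn z (Set.Ioo 0 1) := by
    refine strictMonoOn_of_deriv_pos (convex_Ioo 0 1)
      (fun s hs => (hz s hs).continuousAt.continuousWithinAt) fun s hs => ?_
    rw [interior_Ioo] at hs
    rw [(hz s hs).deriv]
    exact hz'pos s
  have hzw : ∀ s ∈ Set.Ioo (0 : ℝ) 1, HasDerivWithinAt z (z' s) (Set.Ioo 0 1) s :=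
    fun s hs => (hz s hs).hasDerivWithinAt
  have hint : IntegrableOn (fun s => |z' s| • H (z s)) (Set.Ioo 0 1) :=
    (integrableOn_image_iff_integrableOn_abs_deriv_smul measurableSet_Ioo hzw
      hzmono.injOn H).1 hHi.integrableOn
  have hpoint (s : ℝ) : A ^ l * B ^ (1 - l) ≤ |z' s| • H (z s) := by
    rw [abs_of_pos (hz'pos s), smul_eq_mul]
    refine le_trans (le_of_eq ?_) (mul_le_mul (hamgm s) (hFGH (u s) (v s))
      (mul_nonneg (rpow_nonneg (hF _).le _) (rpow_nonneg (hG _).le _)) (hz'pos s).le)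
    rw [mul_mul_mul_comm, ← mul_rpow (div_pos hA (hF _)).le (hF _).le,
      ← mul_rpow (div_pos hB (hG _)).le (hG _).le, div_mul_cancel₀ _ (hF _).ne',
      div_mul_cancel₀ _ (hG _).ne']
  calc A ^ l * B ^ (1 - l) = ∫ _ in Set.Ioo (0 : ℝ) 1, A ^ l * B ^ (1 - l) := by simp
    _ ≤ ∫ s in Set.Ioo (0 : ℝ) 1, |z' s| • H (z s) :=
      setIntegral_mono_on (integrableOn_const (by simp)) hint measurableSet_Ioo fun s _ => hpoint s
    _ = ∫ x in z '' Set.Ioo 0 1, H x :=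
      (integral_image_eq_integral_abs_deriv_smul measurableSet_Ioo hzw hzmono.injOn H).symm
    _ ≤ ∫ x, H x := setIntegral_le_integral hHi (Filter.Eventually.of_forall hH)

/-- A strictly positive, continuous, integrable, log-concave function is bounded. -/
lemma exists_forall_le_of_integrable_of_log_concave {f : ℝ → ℝ} (hpos : ∀ x, 0 < f x)
    (hc : Continuous f) (hi : Integrable f)
    (hlc : ∀ x y : ℝ, ∀ l : ℝ, 0 ≤ l → l ≤ 1 →
      f x ^ l * f y ^ (1 - l) ≤ f (l * x + (1 - l) * y)) :
    ∃ C, ∀ x, f x ≤ C := by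
  set R := (∫ x, f x) / f 0 with hR
  obtain ⟨C, hC⟩ := (isCompact_Icc (a := -R) (b := R)).bddAbove_image hc.continuousOn
  refine ⟨max C (f 0), fun x => ?_⟩
  rcases le_or_gt (f x) (f 0) with h | h
  · exact le_max_of_le_right h
  refine le_max_of_le_left (hC ⟨x, abs_le.1 ?_, rfl⟩)
  have hseg : ∀ t ∈ Set.uIcc 0 x, f 0 ≤ f t := by
    intro t ht
    rw [← segment_eq_uIcc] at ht
    obtain ⟨a, b, ha, hb, hab, rfl⟩ := ht
    obtain rfl : a = 1 - b := by linarith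
    have h1 := hlc x 0 b hb (by linarith)
    have h2 : f 0 ^ b * f 0 ^ (1 - b) ≤ f x ^ b * f 0 ^ (1 - b) :=
      mul_le_mul_of_nonneg_right (rpow_le_rpow (hpos 0).le h.le hb)
        (rpow_nonneg (hpos 0).le _)
    rw [← rpow_add (hpos 0), add_sub_cancel, rpow_one] at h2
    simpa [mul_comm] using h2.trans h1
  rw [hR, le_div_iff₀ (hpos 0)]
  calc |x| * f 0 = ∫ _ in Set.uIcc 0 x, f 0 := by simp [measureReal_def]
    _ ≤ ∫ t in Set.uIcc 0 x, f t :=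
      setIntegral_mono_on (by simp) hi.integrableOn measurableSet_uIcc hseg
    _ ≤ ∫ t, f t := setIntegral_le_integral hi (Filter.Eventually.of_forall fun t => (hpos t).le)

/-- The convolution of two strictly positive, continuous, integrable, log-concave
functions on ℝ is strictly positive and log-concave. -/
theorem convolution_log_concave (f g : ℝ → ℝ)
    (hfpos : ∀ x, 0 < f x) (hgpos : ∀ x, 0 < g x)
    (hfc : Continuous f) (hgc : Continuous g)
    (hfi : Integrable f) (hgi : Integrable g)
    (hflc : ∀ x y : ℝ, ∀ l : ℝ, 0 ≤ l → l ≤ 1 →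
      f x ^ l * f y ^ (1 - l) ≤ f (l*x + (1 - l)*y))
    (hglc : ∀ x y : ℝ, ∀ l : ℝ, 0 ≤ l → l ≤ 1 →
      g x ^ l * g y ^ (1 - l) ≤ g (l*x + (1 - l)*y)) :
    (∀ x : ℝ, 0 < ∫ t : ℝ, f (x - t) * g t) ∧
    (∀ x y : ℝ, ∀ l : ℝ, 0 ≤ l → l ≤ 1 →
      (∫ t : ℝ, f (x - t) * g t) ^ l * (∫ t : ℝ, f (y - t) * g t) ^ (1 - l)
        ≤ ∫ t : ℝ, f ((l*x + (1 - l)*y) - t) * g t) := by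
  obtain ⟨C, hC⟩ := exists_forall_le_of_integrable_of_log_concave hfpos hfc hfi hflc
  have hpos (x t : ℝ) : 0 < f (x - t) * g t := mul_pos (hfpos _) (hgpos _)
  have hcont (x : ℝ) : Continuous fun t => f (x - t) * g t := by fun_prop
  have hint (x : ℝ) : Integrable fun t => f (x - t) * g t :=
    hgi.bdd_mul (c := C) (hfc.comp (continuous_const.sub continuous_id)).aestronglyMeasurable
      (Filter.Eventually.of_forall fun t => by
        simpa [abs_of_pos (hfpos (x - t))] using hC (x - t))
  refine ⟨fun x => integral_pos_of_forall_pos (hpos x) (hint x), fun x y l hl0 hl1 => ?_⟩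
  refine prekopa_leindler_real hl0 hl1 (hpos x) (hpos y) (fun t => (hpos _ t).le)
    (hcont x) (hcont y) (hint x) (hint y) (hint _) fun a b => ?_
  rw [mul_rpow (hfpos _).le (hgpos _).le, mul_rpow (hfpos _).le (hgpos _).le,
    mul_mul_mul_comm]
  refine mul_le_mul ?_ (hglc a b l hl0 hl1)
    (mul_nonneg (rpow_nonneg (hgpos _).le _) (rpow_nonneg (hgpos _).le _)) (hfpos _).le
  rw [show l * x + (1 - l) * y - (l * a + (1 - l) * b) = l * (x - a) + (1 - l) * (y - b) by ring]
  exact hflc (x - a) (y - b) l hl0 hl1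
end

section
/- Let 0 < α < 8 and let A, B ≥ 0. There exists K > 0 with the following property: for every twice continuously differentiable function u : ℝ → ℂ with u, u', u'' square-integrable and |u|^{α+2} integrable, if E(u) := (1/2)∫_ℝ(|u''|² + |u'|² − (2/(α+2))|u|^{α+2}) dx ≤ A and F(u) := (1/2)∫_ℝ |u|² dx ≤ B, then ∫_ℝ |u''(x)|² dx ≤ K. -/
open Real MeasureTheory

section Interpolation

variable {E : Type*} [NormedAddCommGroup E]

lemma integrable_norm_mul_norm_of_sq {f g : ℝ → E} (hf : Continuous f) (hg : Continuous g)
    (hf2 : Integrable fun x => ‖f x‖ ^ 2) (hg2 : Integrable fun x => ‖g x‖ ^ 2) :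
    Integrable fun x => ‖f x‖ * ‖g x‖ := by
  refine (hf2.add hg2).mono' (hf.norm.mul hg.norm).aestronglyMeasurable (.of_forall fun x => ?_)
  rw [Real.norm_of_nonneg (by positivity), Pi.add_apply]
  nlinarith [sq_nonneg (‖f x‖ - ‖g x‖), sq_nonneg (‖f x‖), sq_nonneg (‖g x‖)]

/-- The Cauchy–Schwarz inequality for the norms of two continuous functions. -/
lemma sq_integral_norm_mul_norm_le {f g : ℝ → E} (hf : Continuous f) (hg : Continuous g)
    (hf2 : Integrable fun x => ‖f x‖ ^ 2) (hg2 : Integrable fun x => ‖g x‖ ^ 2) :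
    (∫ x, ‖f x‖ * ‖g x‖) ^ 2 ≤ (∫ x, ‖f x‖ ^ 2) * ∫ x, ‖g x‖ ^ 2 := by
  have hfg := integrable_norm_mul_norm_of_sq hf hg hf2 hg2
  have key : ∀ t : ℝ, 0 ≤ (∫ x, ‖f x‖ ^ 2) * (t * t) + (2 * ∫ x, ‖f x‖ * ‖g x‖) * t
      + ∫ x, ‖g x‖ ^ 2 := by
    intro t
    calc 0 ≤ ∫ x, (t * ‖f x‖ + ‖g x‖) ^ 2 := integral_nonneg fun x => sq_nonneg _
      _ = ∫ x, (t * t * ‖f x‖ ^ 2 + 2 * t * (‖f x‖ * ‖g x‖) + ‖g x‖ ^ 2) := by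
          congr 1; ext x; ring
      _ = _ := by
          rw [integral_add (by exact (hf2.const_mul _).add (hfg.const_mul _)) hg2,
            integral_add (hf2.const_mul _) (hfg.const_mul _), integral_const_mul,
            integral_const_mul]
          ring
  have := discrim_le_zero key
  unfold discrim at this
  linarith

variable [InnerProductSpace ℝ E]

lemma integrable_inner_of_sq {f g : ℝ → E} (hf : Continuous f) (hg : Continuous g)
    (hf2 : Integrable fun x => ‖f x‖ ^ 2) (hg2 : Integrable fun x => ‖g x‖ ^ 2) :
    Integrable fun x => inner ℝ (f x) (g x) :=
  (integrable_norm_mul_norm_of_sq hf hg hf2 hg2).mono' (hf.inner hg).aestronglyMeasurable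
    (.of_forall fun x => norm_inner_le_norm (f x) (g x))

/-- Integration by parts gives `‖u'‖₂² ≤ ‖u‖₂ ‖u''‖₂`. -/
lemma sq_integral_deriv_sq_le {u u' u'' : ℝ → E} (h1 : ∀ x, HasDerivAt u (u' x) x)
    (h2 : ∀ x, HasDerivAt u' (u'' x) x) (hc : Continuous u'')
    (hu : Integrable fun x => ‖u x‖ ^ 2) (hu' : Integrable fun x => ‖u' x‖ ^ 2)
    (hu'' : Integrable fun x => ‖u'' x‖ ^ 2) :
    (∫ x, ‖u' x‖ ^ 2) ^ 2 ≤ (∫ x, ‖u x‖ ^ 2) * ∫ x, ‖u'' x‖ ^ 2 := by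
  have cu : Continuous u := continuous_iff_continuousAt.2 fun x => (h1 x).continuousAt
  have cu' : Continuous u' := continuous_iff_continuousAt.2 fun x => (h2 x).continuousAt
  have hi := integrable_inner_of_sq cu hc hu hu''
  have hz : ∫ x, (inner ℝ (u x) (u'' x) + ‖u' x‖ ^ 2) = 0 :=
    integral_eq_zero_of_hasDerivAt_of_integrable
      (fun x => by simpa only [real_inner_self_eq_norm_sq] using (h1 x).inner ℝ (h2 x))
      (hi.add hu') (integrable_inner_of_sq cu cu' hu hu')
  rw [integral_add hi hu'] at hz
  have hle : ∫ x, ‖u' x‖ ^ 2 ≤ ∫ x, ‖u x‖ * ‖u'' x‖ :=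
    calc ∫ x, ‖u' x‖ ^ 2 = ∫ x, -inner ℝ (u x) (u'' x) := by rw [integral_neg]; linarith
      _ ≤ _ := integral_mono hi.neg (integrable_norm_mul_norm_of_sq cu hc hu hu'') fun x =>
          (neg_le_abs _).trans (abs_real_inner_le_norm _ _)
  have h0 : 0 ≤ ∫ x, ‖u' x‖ ^ 2 := integral_nonneg fun x => sq_nonneg _
  exact (pow_le_pow_left₀ h0 hle 2).trans (sq_integral_norm_mul_norm_le cu hc hu hu'')

/-- The Agmon-type inequality `‖u‖_∞⁴ ≤ 4 ‖u‖₂² ‖u'‖₂²`. -/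
lemma norm_pow_four_le {u u' : ℝ → E} (h1 : ∀ x, HasDerivAt u (u' x) x) (cu' : Continuous u')
    (hu : Integrable fun x => ‖u x‖ ^ 2) (hu' : Integrable fun x => ‖u' x‖ ^ 2) (x : ℝ) :
    ‖u x‖ ^ 4 ≤ 4 * ((∫ x, ‖u x‖ ^ 2) * ∫ x, ‖u' x‖ ^ 2) := by
  have cu : Continuous u := continuous_iff_continuousAt.2 fun x => (h1 x).continuousAt
  have hi := (integrable_inner_of_sq cu cu' hu hu').const_mul 2
  have hm := (integrable_norm_mul_norm_of_sq cu cu' hu hu').const_mul 2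
  have hd : ∀ y, HasDerivAt (fun x => ‖u x‖ ^ 2) (2 * inner ℝ (u y) (u' y)) y :=
    fun y => (h1 y).norm_sq
  have h0 := tendsto_zero_of_hasDerivAt_of_integrableOn_Iic (a := x)
    (fun y _ => hd y) hi.integrableOn hu.integrableOn
  have hx := integral_Iic_of_hasDerivAt_of_tendsto' (a := x) (fun y _ => hd y) hi.integrableOn h0
  have hle : ‖u x‖ ^ 2 ≤ 2 * ∫ x, ‖u x‖ * ‖u' x‖ :=
    calc ‖u x‖ ^ 2 = ∫ y in Set.Iic x, 2 * inner ℝ (u y) (u' y) := by rw [hx, sub_zero]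
      _ ≤ ∫ y in Set.Iic x, 2 * (‖u y‖ * ‖u' y‖) :=
          integral_mono hi.integrableOn hm.integrableOn fun y =>
            mul_le_mul_of_nonneg_left (real_inner_le_norm _ _) zero_le_two
      _ ≤ ∫ y, 2 * (‖u y‖ * ‖u' y‖) :=
          setIntegral_le_integral hm (.of_forall fun y => by positivity)
      _ = _ := integral_const_mul _ _
  have hsq := pow_le_pow_left₀ (sq_nonneg _) hle 2
  have hcs := sq_integral_norm_mul_norm_le cu cu' hu hu'
  nlinarith

/-- The Gagliardo–Nirenberg inequality `‖u‖_∞⁸ ≤ 16 ‖u‖₂⁶ ‖u''‖₂²`. -/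
lemma norm_pow_eight_le {u u' u'' : ℝ → E} (h1 : ∀ x, HasDerivAt u (u' x) x)
    (h2 : ∀ x, HasDerivAt u' (u'' x) x) (hc : Continuous u'')
    (hu : Integrable fun x => ‖u x‖ ^ 2) (hu' : Integrable fun x => ‖u' x‖ ^ 2)
    (hu'' : Integrable fun x => ‖u'' x‖ ^ 2) (x : ℝ) :
    ‖u x‖ ^ 8 ≤ 16 * (∫ x, ‖u x‖ ^ 2) ^ 3 * ∫ x, ‖u'' x‖ ^ 2 := by
  have cu' : Continuous u' := continuous_iff_continuousAt.2 fun x => (h2 x).continuousAt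
  have hm : 0 ≤ ∫ x, ‖u x‖ ^ 2 := integral_nonneg fun x => sq_nonneg _
  calc ‖u x‖ ^ 8 = (‖u x‖ ^ 4) ^ 2 := by ring
    _ ≤ (4 * ((∫ x, ‖u x‖ ^ 2) * ∫ x, ‖u' x‖ ^ 2)) ^ 2 :=
        pow_le_pow_left₀ (by positivity) (norm_pow_four_le h1 cu' hu hu' x) 2
    _ = 16 * (∫ x, ‖u x‖ ^ 2) ^ 2 * (∫ x, ‖u' x‖ ^ 2) ^ 2 := by ring
    _ ≤ 16 * (∫ x, ‖u x‖ ^ 2) ^ 2 * ((∫ x, ‖u x‖ ^ 2) * ∫ x, ‖u'' x‖ ^ 2) :=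
        mul_le_mul_of_nonneg_left (sq_integral_deriv_sq_le h1 h2 hc hu hu' hu'') (by positivity)
    _ = _ := by ring

end Interpolation

/-- A sublinear self-bound `k ≤ a + b k ^ θ` with `θ < 1` bounds `k`. -/
lemma le_of_le_add_mul_rpow {a b k θ : ℝ} (ha : 0 ≤ a) (hθ0 : 0 ≤ θ)
    (hθ1 : θ < 1) (h : k ≤ a + b * k ^ θ) : k ≤ max 1 ((a + b) ^ (1 - θ)⁻¹) := by
  rcases le_total k 1 with hk | hk
  · exact hk.trans (le_max_left _ _)
  refine le_trans ?_ (le_max_right _ _)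
  have hk0 : 0 < k := by linarith
  have hp : 0 < k ^ θ := rpow_pos_of_pos hk0 _
  have hk1 : k ^ (1 - θ) ≤ a + b := by
    rw [rpow_sub hk0, rpow_one, div_le_iff₀ hp]
    nlinarith [one_le_rpow hk hθ0]
  have := rpow_le_rpow (by positivity) hk1 (z := (1 - θ)⁻¹) (by
    rw [inv_nonneg]; linarith)
  rwa [rpow_rpow_inv hk0.le (by linarith)] at this

/-- A priori bound: for `0 < α < 8`, bounds on the energy `E(u)` and the mass `F(u)`
of the fourth-order NLS give a uniform bound on `∫‖u''‖²`. -/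
theorem apriori_bound_4NLS (α : ℝ) (hα0 : 0 < α) (hα8 : α < 8)
    (A B : ℝ) (hA : 0 ≤ A) (hB : 0 ≤ B) :
    ∃ K : ℝ, 0 < K ∧ ∀ u : ℝ → ℂ,
      ContDiff ℝ 2 u →
      Integrable (fun x => ‖u x‖^2) →
      Integrable (fun x => ‖deriv u x‖^2) →
      Integrable (fun x => ‖iteratedDeriv 2 u x‖^2) →
      Integrable (fun x => ‖u x‖ ^ (α + 2)) →
      (1/2) * (∫ x : ℝ, (‖iteratedDeriv 2 u x‖^2 + ‖deriv u x‖^2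
        - (2/(α + 2)) * ‖u x‖ ^ (α + 2))) ≤ A →
      (1/2) * (∫ x : ℝ, ‖u x‖^2) ≤ B →
      ∫ x : ℝ, ‖iteratedDeriv 2 u x‖^2 ≤ K := by
  refine ⟨max 1 ((2 * A + (16 * (2 * B) ^ 3) ^ (α / 8) * (2 * B)) ^ (1 - α / 8)⁻¹),
    by positivity, fun u hu hm hp hk hn hE hF => ?_⟩
  have h1 : ∀ x, HasDerivAt u (deriv u x) x := fun x =>
    ((hu.differentiable (by norm_num)) x).hasDerivAt
  have h2 : ∀ x, HasDerivAt (deriv u) (iteratedDeriv 2 u x) x := fun x => by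
    have := (hu.differentiable_iteratedDeriv 1 (by norm_num)) x
    rw [iteratedDeriv_one] at this
    rw [iteratedDeriv_succ, iteratedDeriv_one]
    exact this.hasDerivAt
  have hc : Continuous (iteratedDeriv 2 u) := hu.continuous_iteratedDeriv 2 le_rfl
  have hGN := norm_pow_eight_le h1 h2 hc hm hp hk
  rw [integral_sub (by exact hk.add hp) (hn.const_mul _), integral_add hk hp, integral_const_mul] at hE
  set k := ∫ x, ‖iteratedDeriv 2 u x‖ ^ 2
  set m := ∫ x, ‖u x‖ ^ 2
  have hk0 : 0 ≤ k := integral_nonneg fun x => sq_nonneg _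
  have hm0 : 0 ≤ m := integral_nonneg fun x => sq_nonneg _
  have hp0 : 0 ≤ ∫ x, ‖deriv u x‖ ^ 2 := integral_nonneg fun x => sq_nonneg _
  have hn0 : 0 ≤ ∫ x, ‖u x‖ ^ (α + 2) := integral_nonneg fun x => by positivity
  have hmB : m ≤ 2 * B := by linarith
  have hsup : ∀ x, ‖u x‖ ^ α ≤ (16 * (2 * B) ^ 3) ^ (α / 8) * k ^ (α / 8) := fun x =>
    calc ‖u x‖ ^ α = (‖u x‖ ^ 8) ^ (α / 8) := by
          rw [← rpow_natCast, ← rpow_mul (norm_nonneg _)]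
          congr 1; push_cast; ring
      _ ≤ (16 * (2 * B) ^ 3 * k) ^ (α / 8) := by
          refine rpow_le_rpow (by positivity) ((hGN x).trans ?_) (by positivity)
          gcongr
      _ = _ := mul_rpow (by positivity) hk0
  have hnl : ∫ x, ‖u x‖ ^ (α + 2) ≤ (16 * (2 * B) ^ 3) ^ (α / 8) * k ^ (α / 8) * m := by
    rw [← integral_const_mul]
    refine integral_mono hn (hm.const_mul _) fun x => ?_
    dsimp only
    rw [rpow_add_of_nonneg (norm_nonneg _) hα0.le zero_le_two, rpow_two]
    exact mul_le_mul_of_nonneg_right (hsup x) (sq_nonneg _)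
  have hcoef : 2 / (α + 2) * ∫ x, ‖u x‖ ^ (α + 2) ≤ ∫ x, ‖u x‖ ^ (α + 2) :=
    mul_le_of_le_one_left hn0 (by rw [div_le_one (by linarith)]; linarith)
  refine le_of_le_add_mul_rpow (by positivity) (by positivity) (by linarith) ?_
  have hmul := mul_le_mul_of_nonneg_left hmB
    (show 0 ≤ (16 * (2 * B) ^ 3) ^ (α / 8) * k ^ (α / 8) by positivity)
  linarith
end

section
/- Let α > 0 and let φ(x) = a₀ (sech(b₀ x))^{4/α} with a₀ = ((3α³ + 22α² + 48α + 32)/(2(α² + 4α + 8)²))^{1/α}, b₀ = α/(2√(α² + 4α + 8)), and ω₀ = 4(α² + 4α + 4)/(α⁴ + 8α³ + 32α² + 64α + 64). Set τ₀ = ∫_ℝ φ(x)^{α+2} dx. Then for every twice continuously differentiable u : ℝ → ℂ with u, u', u'' square-integrable and ∫_ℝ |u(x)|^{α+2} dx = τ₀, one has (1/2)∫_ℝ (|u''|² + |u'|² + ω₀|u|²) dx ≥ (1/2)∫_ℝ (φ''(x)² + φ'(x)² + ω₀ φ(x)²) dx = τ₀/2. -/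
open Real MeasureTheory

namespace SolitaryWave

open Set Filter Topology

section Resolvent

variable {E : Type*} [NormedAddCommGroup E] [NormedSpace ℝ E]

/-- The decaying solution `h` of `dh/dx + m h = f`. -/
noncomputable def causalSolution (m : ℝ) (f : ℝ → E) (x : ℝ) : E :=
  exp (-(m * x)) • ∫ y in Iic x, exp (m * y) • f y

lemma integrableOn_exp_smul_Iic {m : ℝ} (hm : 0 < m) {f : ℝ → E} (hf : Continuous f) {C : ℝ}
    (hC : ∀ x, ‖f x‖ ≤ C) (x : ℝ) : IntegrableOn (fun y => exp (m * y) • f y) (Iic x) := by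
  refine Integrable.mono' ((integrableOn_exp_mul_Iic hm x).mul_const C)
    (by fun_prop) (ae_of_all _ fun y => ?_)
  rw [norm_smul, norm_of_nonneg (exp_pos _).le]
  gcongr
  exact hC y

lemma hasDerivAt_causalSolution [CompleteSpace E] {m : ℝ} (hm : 0 < m) {f : ℝ → E}
    (hf : Continuous f) {C : ℝ} (hC : ∀ x, ‖f x‖ ≤ C) (x : ℝ) :
    HasDerivAt (causalSolution m f) (f x - m • causalSolution m f x) x := by
  have hi := integrableOn_exp_smul_Iic hm hf hC
  have hcont : Continuous fun y => exp (m * y) • f y := by fun_prop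
  have h1 : HasDerivAt (fun x => ∫ y in Iic x, exp (m * y) • f y) (exp (m * x) • f x) x := by
    have h := (intervalIntegral.integral_hasDerivAt_right (hcont.intervalIntegrable 0 x)
      (hcont.stronglyMeasurableAtFilter _ _) hcont.continuousAt).const_add
      (∫ y in Iic 0, exp (m * y) • f y)
    refine h.congr_of_eventuallyEq (Eventually.of_forall fun z => ?_)
    simp only [← intervalIntegral.integral_Iic_sub_Iic (hi 0) (hi z)]
    abel
  have h2 : HasDerivAt (fun x => exp (-(m * x))) (-(exp (-(m * x)) * m)) x := by
    have := ((hasDerivAt_id x).const_mul m).neg.exp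
    simpa using this
  refine (h2.smul h1).congr_deriv ?_
  simp only [causalSolution, smul_smul, ← exp_add, neg_add_cancel, exp_zero, one_smul, neg_smul]
  rw [mul_comm m (exp _), sub_eq_add_neg]

lemma norm_causalSolution_le {m : ℝ} (hm : 0 < m) {f : ℝ → E} {g : ℝ → ℝ}
    (hg : Continuous g) (hfg : ∀ x, ‖f x‖ ≤ g x) {C : ℝ} (hC : ∀ x, g x ≤ C) (x : ℝ) :
    ‖causalSolution m f x‖ ≤ causalSolution m g x := by
  have hgC : ∀ x, ‖g x‖ ≤ C := fun x => by
    rw [norm_of_nonneg ((norm_nonneg _).trans (hfg x))]; exact hC x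
  rw [causalSolution, causalSolution, norm_smul, norm_of_nonneg (exp_pos _).le, smul_eq_mul]
  gcongr
  refine norm_integral_le_of_norm_le (integrableOn_exp_smul_Iic hm hg hgC x)
    (ae_of_all _ fun y => ?_)
  rw [norm_smul, norm_of_nonneg (exp_pos _).le, smul_eq_mul]
  gcongr
  exact hfg y

lemma causalSolution_le {m : ℝ} (hm : 0 < m) {g : ℝ → ℝ}
    (hg : Continuous g) (hg0 : ∀ x, 0 ≤ g x) {C : ℝ} (hC : ∀ x, g x ≤ C) (x : ℝ) :
    causalSolution m g x ≤ C / m := by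
  have hgC : ∀ x, ‖g x‖ ≤ C := fun x => by rw [norm_of_nonneg (hg0 x)]; exact hC x
  have h : ∫ y in Iic x, exp (m * y) • g y ≤ ∫ y in Iic x, exp (m * y) * C := by
    refine integral_mono (integrableOn_exp_smul_Iic hm hg hgC x)
      ((integrableOn_exp_mul_Iic hm x).mul_const C) fun y => ?_
    simp only [smul_eq_mul]
    gcongr
    exact hC y
  rw [integral_mul_const, integral_exp_mul_Iic hm] at h
  calc causalSolution m g x ≤ exp (-(m * x)) * (exp (m * x) / m * C) := by
        rw [causalSolution, smul_eq_mul]; gcongr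
    _ = C / m := by
        rw [exp_neg]; field_simp

set_option linter.unnecessarySeqFocus false in
lemma hasDerivAt_resolvent [CompleteSpace E] {m : ℝ} (hm : 0 < m) {f : ℝ → E}
    (hf : Continuous f) {C : ℝ} (hC : ∀ x, ‖f x‖ ≤ C) (x : ℝ) :
    HasDerivAt (fun x => (2 * m)⁻¹ •
        (causalSolution m f x + causalSolution m (fun y => f (-y)) (-x)))
      ((2 : ℝ)⁻¹ • (causalSolution m (fun y => f (-y)) (-x) - causalSolution m f x)) x ∧
    HasDerivAt (fun x => (2 : ℝ)⁻¹ •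
        (causalSolution m (fun y => f (-y)) (-x) - causalSolution m f x))
      (m ^ 2 • ((2 * m)⁻¹ • (causalSolution m f x + causalSolution m (fun y => f (-y)) (-x)))
        - f x) x := by
  have h1 := hasDerivAt_causalSolution hm hf hC x
  have h2 := (hasDerivAt_causalSolution hm (f := fun y => f (-y)) (by fun_prop)
    (fun y => hC (-y)) (-x)).scomp x (hasDerivAt_neg x)
  rw [neg_neg] at h2
  refine ⟨((h1.add h2).const_smul (2 * m)⁻¹).congr_deriv ?_,
    ((h2.sub h1).const_smul (2 : ℝ)⁻¹).congr_deriv ?_⟩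
  · match_scalars <;> field_simp <;> ring
  · match_scalars <;> field_simp <;> ring

/-- Bounded data `f` dominated by `g`: solutions of `-∂²F + m² F = f` and `-∂²G + m² G = g` with
`F` dominated by `G`. -/
lemma exists_resolvent [CompleteSpace E] {m : ℝ} (hm : 0 < m) {f : ℝ → E} {g : ℝ → ℝ}
    (hf : Continuous f) (hg : Continuous g) (hfg : ∀ x, ‖f x‖ ≤ g x) {C : ℝ}
    (hC : ∀ x, g x ≤ C) :
    ∃ (F F' : ℝ → E) (G G' : ℝ → ℝ), (∀ x, HasDerivAt F (F' x) x) ∧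
      (∀ x, HasDerivAt F' (m ^ 2 • F x - f x) x) ∧ (∀ x, HasDerivAt G (G' x) x) ∧
      (∀ x, HasDerivAt G' (m ^ 2 * G x - g x) x) ∧ (∀ x, ‖F x‖ ≤ G x) ∧
      (∀ x, ‖F' x‖ ≤ m * G x) ∧ (∀ x, |G' x| ≤ m * G x) ∧ (∀ x, G x ≤ C / m ^ 2) := by
  have hg0 : ∀ x, 0 ≤ g x := fun x => (norm_nonneg _).trans (hfg x)
  have hgC : ∀ x, ‖g x‖ ≤ C := fun x => by rw [norm_of_nonneg (hg0 x)]; exact hC x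
  have hfC : ∀ x, ‖f x‖ ≤ C := fun x => (hfg x).trans (hC x)
  have n1 := norm_causalSolution_le (E := E) hm hg hfg hC
  have n2 := fun x => norm_causalSolution_le (E := E) hm (f := fun y => f (-y))
    (g := fun y => g (-y)) (by fun_prop) (fun y => hfg (-y)) (fun y => hC (-y)) (-x)
  have p1 := fun x => (norm_nonneg _).trans (n1 x)
  have p2 := fun x => (norm_nonneg _).trans (n2 x)
  have b1 := causalSolution_le hm hg hg0 hC
  have b2 := fun x => causalSolution_le hm (g := fun y => g (-y)) (by fun_prop)
    (fun y => hg0 (-y)) (fun y => hC (-y)) (-x)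
  refine ⟨_, _, _, _, fun x => (hasDerivAt_resolvent hm hf hfC x).1,
    fun x => (hasDerivAt_resolvent hm hf hfC x).2,
    fun x => (hasDerivAt_resolvent hm hg hgC x).1, fun x => (hasDerivAt_resolvent hm hg hgC x).2,
    fun x => ?_, fun x => ?_, fun x => ?_, fun x => ?_⟩
  · rw [norm_smul, norm_of_nonneg (by positivity), smul_eq_mul]
    gcongr
    exact (norm_add_le _ _).trans (add_le_add (n1 x) (n2 x))
  · rw [norm_smul, norm_of_nonneg (by positivity), smul_eq_mul]
    calc _ ≤ (2 : ℝ)⁻¹ * (causalSolution m (fun y => g (-y)) (-x) + causalSolution m g x) := by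
          gcongr
          exact (norm_sub_le _ _).trans (add_le_add (n2 x) (n1 x))
      _ = _ := by field_simp; ring
  · rw [smul_eq_mul, smul_eq_mul, abs_le]
    have e : m * ((2 * m)⁻¹ * (causalSolution m g x + causalSolution m (fun y => g (-y)) (-x)))
        = 2⁻¹ * (causalSolution m g x + causalSolution m (fun y => g (-y)) (-x)) := by
      field_simp
    rw [e]
    constructor <;> linarith [p1 x, p2 x]
  · rw [smul_eq_mul]
    calc _ ≤ (2 * m)⁻¹ * (C / m + C / m) := by gcongr; exacts [b1 x, b2 x]
      _ = _ := by field_simp; ring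

/-- Bounded solutions of `-∂²G + m² G = g` inherit square integrability. -/
lemma memLp_two_resolvent {m : ℝ} (hm : 0 < m) {g G G' : ℝ → ℝ} (hg : Continuous g)
    (hg2 : MemLp g 2) (h1 : ∀ x, HasDerivAt G (G' x) x)
    (h2 : ∀ x, HasDerivAt G' (m ^ 2 * G x - g x) x) (h0 : ∀ x, 0 ≤ G x)
    (h3 : ∀ x, |G' x| ≤ m * G x) {B : ℝ} (hB : ∀ x, G x ≤ B) : MemLp G 2 := by
  have cG : Continuous G := continuous_iff_continuousAt.2 fun x => (h1 x).continuousAt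
  have cG' : Continuous G' := continuous_iff_continuousAt.2 fun x => (h2 x).continuousAt
  have ig := (memLp_two_iff_integrable_sq hg.aestronglyMeasurable).1 hg2
  rw [memLp_two_iff_integrable_sq cG.aestronglyMeasurable]
  have hbd : ∀ x, |G x * G' x| ≤ m * B ^ 2 := fun x => by
    have hBx := hB x
    have := h0 x
    rw [abs_mul, abs_of_nonneg (h0 x)]
    calc G x * |G' x| ≤ G x * (m * G x) := by gcongr; exact h3 x
      _ = m * G x ^ 2 := by ring
      _ ≤ m * B ^ 2 := by gcongr
  refine integrable_of_intervalIntegral_norm_bounded (l := atTop) (a := fun n : ℝ => -n)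
    (b := fun n => n) (2 / m ^ 2 * (2 * (m * B ^ 2) + (∫ x, g x ^ 2) / (2 * m ^ 2)))
    (fun n => ((cG.pow 2).integrableOn_Icc).mono_set Ioc_subset_Icc_self)
    tendsto_neg_atTop_atBot tendsto_id ?_
  filter_upwards [eventually_ge_atTop 0] with n hn
  have hn' : -n ≤ n := by linarith
  have hd : ∀ x, HasDerivAt (fun x => G x * G' x) (G' x * G' x + G x * (m ^ 2 * G x - g x)) x :=
    fun x => (h1 x).mul (h2 x)
  have cd : Continuous fun x => G' x * G' x + G x * (m ^ 2 * G x - g x) := by fun_prop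
  have hI := intervalIntegral.integral_eq_sub_of_hasDerivAt (a := -n) (b := n)
    (fun x _ => hd x) (cd.intervalIntegrable _ _)
  have hgI : ∫ x in -n..n, g x ^ 2 / (2 * m ^ 2) ≤ (∫ x, g x ^ 2) / (2 * m ^ 2) := by
    rw [intervalIntegral.integral_of_le hn', integral_div]
    exact div_le_div_of_nonneg_right
      (setIntegral_le_integral ig (Eventually.of_forall fun x => sq_nonneg (g x))) (by positivity)
  have hle : ∫ x in -n..n, m ^ 2 / 2 * G x ^ 2 ≤
      ∫ x in -n..n, ((G' x * G' x + G x * (m ^ 2 * G x - g x)) + g x ^ 2 / (2 * m ^ 2)) := by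
    refine intervalIntegral.integral_mono hn' (Continuous.intervalIntegrable (by fun_prop) _ _)
      (Continuous.intervalIntegrable (by fun_prop) _ _) fun x => ?_
    have e : (G' x * G' x + G x * (m ^ 2 * G x - g x)) + g x ^ 2 / (2 * m ^ 2)
        - m ^ 2 / 2 * G x ^ 2 = G' x ^ 2 + (m * G x - g x / m) ^ 2 / 2 := by field_simp; ring
    have : 0 ≤ G' x ^ 2 + (m * G x - g x / m) ^ 2 / 2 := by positivity
    simp only
    linarith
  rw [intervalIntegral.integral_add (cd.intervalIntegrable _ _)
    (Continuous.intervalIntegrable (by fun_prop) _ _), hI,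
    intervalIntegral.integral_const_mul] at hle
  have e2 : ∫ x in -n..n, ‖G x ^ 2‖ = ∫ x in -n..n, G x ^ 2 := by
    congr 1; ext x; exact norm_of_nonneg (sq_nonneg _)
  rw [e2]
  have a1 := abs_le.1 (hbd n)
  have a2 := abs_le.1 (hbd (-n))
  have hle' : m ^ 2 / 2 * ∫ x in -n..n, G x ^ 2 ≤
      2 * (m * B ^ 2) + (∫ x, g x ^ 2) / (2 * m ^ 2) := by linarith
  calc ∫ x in -n..n, G x ^ 2 = 2 / m ^ 2 * (m ^ 2 / 2 * ∫ x in -n..n, G x ^ 2) := by field_simp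
    _ ≤ _ := by gcongr

end Resolvent
section Sobolev

variable {E : Type*} [NormedAddCommGroup E] [InnerProductSpace ℝ E]

lemma continuous_of_forall_hasDerivAt {F : Type*} [NormedAddCommGroup F] [NormedSpace ℝ F]
    {u u₁ : ℝ → F} (h : ∀ x, HasDerivAt u (u₁ x) x) : Continuous u :=
  continuous_iff_continuousAt.2 fun x => (h x).continuousAt

lemma integrable_inner_of_memLp_two {f g : ℝ → E} (hf : MemLp f 2) (hg : MemLp g 2) :
    Integrable fun x => inner ℝ (f x) (g x) := by
  refine Integrable.mono' ((hf.norm.integrable_mul hg.norm))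
    (hf.aestronglyMeasurable.inner hg.aestronglyMeasurable) (ae_of_all _ fun x => ?_)
  exact norm_inner_le_norm (f x) (g x)

lemma integral_inner_deriv {u u₁ v v₁ : ℝ → E} (hu : ∀ x, HasDerivAt u (u₁ x) x)
    (hv : ∀ x, HasDerivAt v (v₁ x) x) (mu : MemLp u 2) (mu₁ : MemLp u₁ 2) (mv : MemLp v 2)
    (mv₁ : MemLp v₁ 2) :
    ∫ x, inner ℝ (u x) (v₁ x) = -∫ x, inner ℝ (u₁ x) (v x) :=
  integral_bilinear_hasDerivAt_right_eq_neg_left_of_integrable (L := innerSL ℝ)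
    (fun x _ => hu x) (fun x _ => hv x) (integrable_inner_of_memLp_two mu mv₁)
    (integrable_inner_of_memLp_two mu₁ mv) (integrable_inner_of_memLp_two mu mv)

lemma tendsto_norm_of_memLp_two {u u₁ : ℝ → E} (hu : ∀ x, HasDerivAt u (u₁ x) x)
    (mu : MemLp u 2) (mu₁ : MemLp u₁ 2) :
    Tendsto (fun x => ‖u x‖) atBot (𝓝 0) ∧ Tendsto (fun x => ‖u x‖) atTop (𝓝 0) := by
  have hd : ∀ x, HasDerivAt (fun x => ‖u x‖ ^ 2) (2 * inner ℝ (u x) (u₁ x)) x :=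
    fun x => (hu x).norm_sq
  have i1 := (integrable_inner_of_memLp_two mu mu₁).const_mul 2
  have i2 := (memLp_two_iff_integrable_sq_norm mu.aestronglyMeasurable).1 mu
  have e : (fun x => ‖u x‖) = fun x => √(‖u x‖ ^ 2) := by ext x; simp
  rw [e, ← Real.sqrt_zero]
  exact ⟨(tendsto_zero_of_hasDerivAt_of_integrableOn_Iic (a := 0) (fun x _ => hd x)
      i1.integrableOn i2.integrableOn).sqrt,
    (tendsto_zero_of_hasDerivAt_of_integrableOn_Ioi (a := 0) (fun x _ => hd x)
      i1.integrableOn i2.integrableOn).sqrt⟩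

lemma exists_forall_norm_le {u u₁ : ℝ → E} (hu : ∀ x, HasDerivAt u (u₁ x) x)
    (mu : MemLp u 2) (mu₁ : MemLp u₁ 2) : ∃ x₀, ∀ x, ‖u x‖ ≤ ‖u x₀‖ := by
  obtain ⟨hb, ht⟩ := tendsto_norm_of_memLp_two hu mu mu₁
  have hc := (continuous_of_forall_hasDerivAt hu).norm
  by_cases h : ∃ y, 0 < ‖u y‖
  · obtain ⟨y, hy⟩ := h
    refine hc.exists_forall_ge' y ?_
    rw [cocompact_eq_atBot_atTop]
    exact eventually_sup.2 ⟨(hb.eventually_lt_const hy).mono fun x hx => hx.le,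
      (ht.eventually_lt_const hy).mono fun x hx => hx.le⟩
  · push Not at h
    exact ⟨0, fun x => (h x).trans (norm_nonneg _)⟩

lemma integrable_norm_rpow_of_memLp_two {F : Type*} [NormedAddCommGroup F] {u : ℝ → F}
    (mu : MemLp u 2) {B : ℝ} (hB : ∀ x, ‖u x‖ ≤ B) {p : ℝ} (hp : 2 ≤ p) :
    Integrable fun x => ‖u x‖ ^ p := by
  have i2 := (memLp_two_iff_integrable_sq_norm mu.aestronglyMeasurable).1 mu
  refine Integrable.mono' (i2.const_mul (B ^ (p - 2)))
    (mu.aestronglyMeasurable.norm.aemeasurable.pow_const p).aestronglyMeasurable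
    (ae_of_all _ fun x => ?_)
  rw [norm_of_nonneg (by positivity)]
  calc ‖u x‖ ^ p = ‖u x‖ ^ (p - 2) * ‖u x‖ ^ (2 : ℝ) := by
        rw [← rpow_add_of_nonneg (norm_nonneg _) (by linarith) (by norm_num)]; ring_nf
    _ ≤ B ^ (p - 2) * ‖u x‖ ^ 2 := by
        rw [rpow_two]
        gcongr
        exact hB x

/-- The bilinear form of `(-∂² + μ₁)(-∂² + μ₂)`, tested against `u`. -/
lemma integral_inner_biresolvent {μ₁ μ₂ : ℝ} (hμ : μ₁ + μ₂ = 1)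
    {u u₁ u₂ V V₁ G G₁ f : ℝ → E}
    (hu : ∀ x, HasDerivAt u (u₁ x) x) (hu₁ : ∀ x, HasDerivAt u₁ (u₂ x) x)
    (hV : ∀ x, HasDerivAt V (V₁ x) x) (hV₁ : ∀ x, HasDerivAt V₁ (μ₂ • V x - G x) x)
    (hG : ∀ x, HasDerivAt G (G₁ x) x) (hG₁ : ∀ x, HasDerivAt G₁ (μ₁ • G x - f x) x)
    (mu : MemLp u 2) (mu₁ : MemLp u₁ 2) (mu₂ : MemLp u₂ 2)
    (mV : MemLp V 2) (mV₁ : MemLp V₁ 2) (mG : MemLp G 2) (mG₁ : MemLp G₁ 2) (mf : MemLp f 2) :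
    ∫ x, inner ℝ (u x) (f x) = ∫ x, (inner ℝ (u₂ x) (μ₂ • V x - G x) + inner ℝ (u₁ x) (V₁ x)
      + μ₁ * μ₂ * inner ℝ (u x) (V x)) := by
  have mV₂ : MemLp (fun x => μ₂ • V x - G x) 2 := (mV.const_smul μ₂).sub mG
  have mG₂ : MemLp (fun x => μ₁ • G x - f x) 2 := (mG.const_smul μ₁).sub mf
  have a1 := integral_inner_deriv hu hG₁ mu mu₁ mG₁ mG₂
  have a2 := integral_inner_deriv hu₁ hG mu₁ mu₂ mG mG₁
  have a3 := integral_inner_deriv hu hV₁ mu mu₁ mV₁ mV₂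
  have a4 := integral_inner_deriv hu₁ hV mu₁ mu₂ mV mV₁
  have I := fun {f g : ℝ → E} (hf : MemLp f 2) (hg : MemLp g 2) =>
    integrable_inner_of_memLp_two hf hg
  simp only [inner_sub_right, inner_smul_right] at a1 a3 ⊢
  rw [integral_sub ((I mu mG).const_mul _) (I mu mf), integral_const_mul] at a1
  rw [integral_sub ((I mu mV).const_mul _) (I mu mG), integral_const_mul] at a3
  have I₁ : Integrable fun x => μ₂ * inner ℝ (u₂ x) (V x) - inner ℝ (u₂ x) (G x) :=
    ((I mu₂ mV).const_mul _).sub (I mu₂ mG)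
  have I₂ : Integrable fun x => μ₂ * inner ℝ (u₂ x) (V x) - inner ℝ (u₂ x) (G x)
      + inner ℝ (u₁ x) (V₁ x) := I₁.add (I mu₁ mV₁)
  rw [integral_add I₂ ((I mu mV).const_mul _), integral_add I₁ (I mu₁ mV₁),
    integral_sub ((I mu₂ mV).const_mul _) (I mu₂ mG), integral_const_mul, integral_const_mul]
  have : μ₁ = 1 - μ₂ := by linarith
  subst this
  linear_combination -a1 + a2 - (1 - μ₂) * a3 - μ₂ * a4

end Sobolev
section Profile

/-- The slope of `t ↦ 1 + 2 t² - t⁴ / 3` at the point `t = √(1 - r ^ (2 / γ))`, as a function of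
the height `r` of the profile. -/
noncomputable def profileSlope (γ r : ℝ) : ℝ :=
  4 * √(1 - r ^ (2 / γ)) - 4 / 3 * √(1 - r ^ (2 / γ)) ^ 3

lemma continuous_profileSlope {γ : ℝ} (hγ : 0 < γ) : Continuous (profileSlope γ) := by
  have : Continuous fun r : ℝ => r ^ (2 / γ) := continuous_rpow_const (by positivity)
  unfold profileSlope
  fun_prop

lemma abs_profileSlope_le {γ r : ℝ} (hr : 0 ≤ r) : |profileSlope γ r| ≤ 4 := by
  have h0 := Real.sqrt_nonneg (1 - r ^ (2 / γ))
  have h1 : √(1 - r ^ (2 / γ)) ≤ 1 := Real.sqrt_le_one.2 (by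
    have := rpow_nonneg hr (2 / γ)
    linarith)
  rw [profileSlope, abs_le]
  constructor <;> nlinarith [pow_le_one₀ h0 h1 (n := 3), pow_nonneg h0 3]

lemma integral_profileSlope {γ : ℝ} (hγ : 0 < γ) {s s₁ : ℝ → ℝ} {x₀ : ℝ}
    (hs : ∀ x, HasDerivAt s (s₁ x) x) (h0 : ∀ x, 0 ≤ s x) (hx₀ : s x₀ = 1)
    (ms : MemLp s 2) (ms₁ : MemLp s₁ 2) :
    Integrable (fun x => s x * profileSlope γ (s x) * s₁ x) ∧
    ∫ x in Iic x₀, s x * profileSlope γ (s x) * s₁ x = ∫ r in (0 : ℝ)..1, r * profileSlope γ r ∧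
    ∫ x in Ioi x₀, s x * profileSlope γ (s x) * s₁ x =
      -∫ r in (0 : ℝ)..1, r * profileSlope γ r := by
  have cs := continuous_of_forall_hasDerivAt hs
  have cψ := continuous_profileSlope hγ
  have cr : Continuous fun r => r * profileSlope γ r := by fun_prop
  have hF : ∀ x, HasDerivAt (fun x => ∫ r in (0 : ℝ)..x, r * profileSlope γ r)
      (x * profileSlope γ x) x := fun x => cr.integral_hasStrictDerivAt 0 x |>.hasDerivAt
  have hFs : ∀ x, HasDerivAt (fun x => ∫ r in (0 : ℝ)..s x, r * profileSlope γ r)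
      (s x * profileSlope γ (s x) * s₁ x) x := fun x => (hF (s x)).comp x (hs x)
  have cF := continuous_of_forall_hasDerivAt hF
  have hint : Integrable fun x => s x * profileSlope γ (s x) * s₁ x := by
    refine Integrable.mono' ((ms.norm.integrable_mul ms₁.norm).const_mul 4)
      ((cs.mul (cψ.comp cs)).aestronglyMeasurable.mul ms₁.aestronglyMeasurable)
      (ae_of_all _ fun x => ?_)
    have := abs_profileSlope_le (γ := γ) (h0 x)
    simp only [Pi.mul_apply, norm_mul, Real.norm_eq_abs]
    nlinarith [mul_nonneg (abs_nonneg (s x)) (abs_nonneg (s₁ x))]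
  obtain ⟨tb, tt⟩ := tendsto_norm_of_memLp_two hs ms ms₁
  have e : (fun x => ‖s x‖) = s := funext fun x => norm_of_nonneg (h0 x)
  rw [e] at tb tt
  have t0 : Tendsto (fun x => ∫ r in (0 : ℝ)..x, r * profileSlope γ r) (𝓝 0) (𝓝 0) := by
    simpa using cF.tendsto 0
  refine ⟨hint, ?_, ?_⟩
  · rw [integral_Iic_of_hasDerivAt_of_tendsto' (fun x _ => hFs x) hint.integrableOn (t0.comp tb),
      hx₀, sub_zero]
  · rw [integral_Ioi_of_hasDerivAt_of_tendsto' (fun x _ => hFs x) hint.integrableOn (t0.comp tt),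
      hx₀, zero_sub]

lemma tangent_le {t r : ℝ} (ht : |t| ≤ 1) (h0 : 0 ≤ r) (h1 : r ≤ 1) :
    (1 - r ^ 2) ^ 2 + (4 * r - 4 / 3 * r ^ 3) * t ≤ 1 + 2 * t ^ 2 - t ^ 4 / 3 := by
  obtain ⟨h2, h3⟩ := abs_le.1 ht
  have e : 1 + 2 * t ^ 2 - t ^ 4 / 3 - ((1 - r ^ 2) ^ 2 + (4 * r - 4 / 3 * r ^ 3) * t) =
      (t - r) ^ 2 * ((6 - t ^ 2 - 2 * t * r - 3 * r ^ 2) / 3) := by ring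
  have : 0 ≤ (6 - t ^ 2 - 2 * t * r - 3 * r ^ 2) / 3 := by nlinarith
  nlinarith [mul_nonneg (sq_nonneg (t - r)) this]

lemma integral_profile_ge {γ κ : ℝ} (hγ : 0 < γ) (hκ : 0 < κ) {s s₁ : ℝ → ℝ} {x₀ : ℝ}
    (hs : ∀ x, HasDerivAt s (s₁ x) x) (h0 : ∀ x, 0 < s x) (hs1 : ∀ x, s x ≤ 1) (hx₀ : s x₀ = 1)
    (hb : ∀ x, |s₁ x| ≤ κ * s x) (ms : MemLp s 2) (ms₁ : MemLp s₁ 2) :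
    Integrable (fun x => s x ^ 2 *
      (1 + 2 * (s₁ x / (κ * s x)) ^ 2 - (s₁ x / (κ * s x)) ^ 4 / 3)) ∧
    (∫ x, s x ^ (2 + 4 / γ)) + 2 / κ * ∫ r in (0 : ℝ)..1, r * profileSlope γ r ≤
      ∫ x, s x ^ 2 * (1 + 2 * (s₁ x / (κ * s x)) ^ 2 - (s₁ x / (κ * s x)) ^ 4 / 3) := by
  obtain ⟨i1, eb, et⟩ := integral_profileSlope hγ hs (fun x => (h0 x).le) hx₀ ms ms₁
  have cs := continuous_of_forall_hasDerivAt hs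
  have i2 := (memLp_two_iff_integrable_sq cs.aestronglyMeasurable).1 ms
  have ht : ∀ x, |s₁ x / (κ * s x)| ≤ 1 := fun x => by
    have := mul_pos hκ (h0 x)
    rw [abs_div, abs_of_pos this, div_le_one this]
    exact hb x
  have ip : Integrable fun x => s x ^ (2 + 4 / γ) := by
    have := integrable_norm_rpow_of_memLp_two ms (B := 1)
      (fun x => by rw [norm_of_nonneg (h0 x).le]; exact hs1 x) (p := 2 + 4 / γ)
      (by have : 0 < 4 / γ := by positivity
          linarith)
    simpa only [norm_of_nonneg (h0 _).le] using this
  have iσ : Integrable (fun x => s x ^ 2 *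
      (1 + 2 * (s₁ x / (κ * s x)) ^ 2 - (s₁ x / (κ * s x)) ^ 4 / 3)) := by
    have mt : AEMeasurable (fun x => s₁ x / (κ * s x)) :=
      ms₁.aestronglyMeasurable.aemeasurable.div (cs.aemeasurable.const_mul κ)
    refine Integrable.mono' (i2.const_mul 3) ?_ (ae_of_all _ fun x => ?_)
    · have := cs.aemeasurable (μ := volume)
      exact AEMeasurable.aestronglyMeasurable (by fun_prop)
    · have h1 := ht x
      set t := s₁ x / (κ * s x)
      have h2 : t ^ 2 ≤ 1 := (sq_le_one_iff_abs_le_one t).2 h1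
      rw [norm_mul, norm_of_nonneg (sq_nonneg (s x)), mul_comm]
      gcongr
      rw [Real.norm_eq_abs, abs_le]
      constructor <;> nlinarith [sq_nonneg t, sq_nonneg (t ^ 2)]
  have pt : ∀ x, ∀ ε : ℝ, |ε| = 1 → s x ^ (2 + 4 / γ) +
      ε * (κ⁻¹ * (s x * profileSlope γ (s x) * s₁ x)) ≤
      s x ^ 2 * (1 + 2 * (s₁ x / (κ * s x)) ^ 2 - (s₁ x / (κ * s x)) ^ 4 / 3) := by
    intro x ε hε
    have hsx := h0 x
    have q0 : 0 ≤ 1 - s x ^ (2 / γ) := by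
      have := rpow_le_one hsx.le (hs1 x) (z := 2 / γ) (by positivity)
      linarith
    have q1 : √(1 - s x ^ (2 / γ)) ≤ 1 := Real.sqrt_le_one.2 (by
      have := rpow_nonneg hsx.le (2 / γ)
      linarith)
    have hε2 : ε ^ 2 = 1 := by rw [← sq_abs, hε, one_pow]
    have hε4 : ε ^ 4 = 1 := by rw [show ε ^ 4 = (ε ^ 2) ^ 2 by ring, hε2, one_pow]
    have h := tangent_le (t := ε * (s₁ x / (κ * s x))) (by rw [abs_mul, hε, one_mul]; exact ht x)
      (Real.sqrt_nonneg _) q1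
    rw [mul_pow, mul_pow, hε2, hε4, one_mul, one_mul, Real.sq_sqrt q0] at h
    have e1 : s x ^ (2 + 4 / γ) = s x ^ 2 * (1 - (1 - s x ^ (2 / γ))) ^ 2 := by
      rw [sub_sub_cancel, rpow_add hsx, rpow_two, ← rpow_mul_natCast hsx.le]
      congr 2
      push_cast
      ring
    have e2 : ε * (κ⁻¹ * (s x * profileSlope γ (s x) * s₁ x)) =
        s x ^ 2 * (profileSlope γ (s x) * (ε * (s₁ x / (κ * s x)))) := by
      field_simp
    rw [e1, e2, ← mul_add]
    gcongr
    exact h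
  refine ⟨iσ, ?_⟩
  have hb1 := setIntegral_mono (s := Iic x₀) (ip.add ((i1.const_mul κ⁻¹).const_mul 1)).integrableOn
    iσ.integrableOn fun x => pt x 1 (by simp)
  have hb2 := setIntegral_mono (s := Ioi x₀)
    (ip.add ((i1.const_mul κ⁻¹).const_mul (-1))).integrableOn
    iσ.integrableOn fun x => pt x (-1) (by simp)
  simp only [Pi.add_apply] at hb1 hb2
  rw [integral_add ip.integrableOn ((i1.const_mul κ⁻¹).const_mul 1).integrableOn,
    integral_const_mul, integral_const_mul, eb] at hb1
  rw [integral_add ip.integrableOn ((i1.const_mul κ⁻¹).const_mul (-1)).integrableOn,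
    integral_const_mul, integral_const_mul, et] at hb2
  rw [← intervalIntegral.integral_Iic_add_Ioi (b := x₀) ip.integrableOn ip.integrableOn,
    ← intervalIntegral.integral_Iic_add_Ioi (b := x₀) iσ.integrableOn iσ.integrableOn,
    div_eq_mul_inv 2 κ]
  linarith

end Profile
section Wave

/-- The profile `sech (b x) ^ γ`. -/
noncomputable def sechPow (γ b x : ℝ) : ℝ := (cosh (b * x))⁻¹ ^ γ

variable {γ b : ℝ}

lemma sechPow_pos (γ b x : ℝ) : 0 < sechPow γ b x :=
  rpow_pos_of_pos (inv_pos.2 (cosh_pos _)) _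

lemma hasDerivAt_tanh_mul (b x : ℝ) :
    HasDerivAt (fun x => tanh (b * x)) (b * (1 - tanh (b * x) ^ 2)) x := by
  have hc : cosh (b * x) ≠ 0 := (cosh_pos _).ne'
  have hl : HasDerivAt (fun x => b * x) b x := by simpa using (hasDerivAt_id x).const_mul b
  have h := hl.sinh.div hl.cosh hc
  have e : (fun x => tanh (b * x)) = fun x => sinh (b * x) / cosh (b * x) :=
    funext fun x => tanh_eq_sinh_div_cosh _
  rw [e]
  refine h.congr_deriv ?_
  rw [tanh_eq_sinh_div_cosh]
  field_simp

lemma hasDerivAt_sechPow (γ b x : ℝ) :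
    HasDerivAt (sechPow γ b) (-(γ * b * tanh (b * x) * sechPow γ b x)) x := by
  have hc := cosh_pos (b * x)
  have hl : HasDerivAt (fun x => b * x) b x := by simpa using (hasDerivAt_id x).const_mul b
  refine ((hl.cosh.inv hc.ne').rpow_const (p := γ) (Or.inl (inv_pos.2 hc).ne')).congr_deriv ?_
  simp only [Pi.inv_apply]
  rw [rpow_sub_one (inv_pos.2 hc).ne', sechPow, tanh_eq_sinh_div_cosh]
  field_simp

lemma inv_cosh_sq (y : ℝ) : (cosh y)⁻¹ ^ 2 = 1 - tanh y ^ 2 := by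
  have hc := (cosh_pos y).ne'
  have := cosh_sq y
  rw [tanh_eq_sinh_div_cosh]
  field_simp
  linarith

lemma sechPow_rpow_two_div (hγ : 0 < γ) (b x : ℝ) :
    sechPow γ b x ^ (2 / γ) = 1 - tanh (b * x) ^ 2 := by
  rw [sechPow, ← rpow_mul (inv_pos.2 (cosh_pos _)).le, mul_div_cancel₀ _ hγ.ne', rpow_two,
    inv_cosh_sq]

lemma sechPow_rpow_critical (hγ : 0 < γ) (b x : ℝ) :
    sechPow γ b x ^ (2 + 4 / γ) = sechPow γ b x ^ 2 * (1 - tanh (b * x) ^ 2) ^ 2 := by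
  rw [rpow_add (sechPow_pos _ _ _), rpow_two, ← sechPow_rpow_two_div hγ,
    ← rpow_mul_natCast (sechPow_pos _ _ _).le]
  congr 2
  push_cast
  ring

lemma sechPow_le_exp (hγ : 0 < γ) (b x : ℝ) :
    sechPow γ b x ^ 2 ≤ 2 ^ (2 * γ) * exp (2 * γ * b * x) := by
  have h : (cosh (b * x))⁻¹ ≤ 2 * exp (b * x) := by
    rw [cosh_eq, inv_div, div_le_iff₀ (by positivity), mul_assoc, mul_add, ← exp_add, ← exp_add]
    have := exp_pos (b * x + b * x)
    simp only [add_neg_cancel, exp_zero]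
    linarith
  calc sechPow γ b x ^ 2 = (cosh (b * x))⁻¹ ^ (2 * γ) := by
        rw [sechPow, ← rpow_mul_natCast (inv_pos.2 (cosh_pos _)).le, mul_comm 2 γ]; norm_cast
    _ ≤ (2 * exp (b * x)) ^ (2 * γ) :=
        rpow_le_rpow (inv_pos.2 (cosh_pos _)).le h (by positivity)
    _ = _ := by
        rw [mul_rpow (by norm_num) (exp_pos _).le, ← exp_mul]; ring_nf

lemma continuous_sechPow (γ b : ℝ) : Continuous (sechPow γ b) :=
  continuous_of_forall_hasDerivAt (hasDerivAt_sechPow γ b)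

lemma integrable_sechPow_sq (hγ : 0 < γ) (hb : 0 < b) :
    Integrable fun x => sechPow γ b x ^ 2 := by
  have hm := ((continuous_sechPow γ b).pow 2).aestronglyMeasurable (μ := volume)
  rw [← integrableOn_univ, ← Iic_union_Ioi (a := (0 : ℝ))]
  refine IntegrableOn.union ?_ ?_
  · refine Integrable.mono' ((integrableOn_exp_mul_Iic (a := 2 * γ * b) (by positivity) 0).const_mul
      (2 ^ (2 * γ))) hm.restrict (ae_of_all _ fun x => ?_)
    rw [norm_of_nonneg (sq_nonneg _)]
    exact sechPow_le_exp hγ b x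
  · refine Integrable.mono' ((integrableOn_exp_mul_Ioi (a := 2 * γ * -b) (by
      have : 0 < 2 * γ * b := by positivity
      linarith) 0).const_mul (2 ^ (2 * γ))) hm.restrict (ae_of_all _ fun x => ?_)
    rw [norm_of_nonneg (sq_nonneg _)]
    have h := sechPow_le_exp hγ (-b) x
    simpa [sechPow] using h

lemma continuous_tanh_mul (b : ℝ) : Continuous fun x => tanh (b * x) :=
  continuous_of_forall_hasDerivAt (hasDerivAt_tanh_mul b)

lemma integrable_sechPow_sq_mul_tanh (hγ : 0 < γ) (hb : 0 < b) (n : ℕ) :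
    Integrable fun x => sechPow γ b x ^ 2 * tanh (b * x) ^ n := by
  refine Integrable.mono' (integrable_sechPow_sq hγ hb)
    (((continuous_sechPow γ b).pow 2).mul ((continuous_tanh_mul b).pow n)).aestronglyMeasurable
    (ae_of_all _ fun x => ?_)
  rw [norm_mul, norm_of_nonneg (sq_nonneg _), norm_pow, Real.norm_eq_abs]
  exact mul_le_of_le_one_right (sq_nonneg _)
    (pow_le_one₀ (abs_nonneg _) (abs_tanh_lt_one _).le)

lemma integral_sechPow_poly (hγ : 0 < γ) (hb : 0 < b) (c d : ℝ) :
    ∫ x, sechPow γ b x ^ 2 * (c + (3 * d - (2 * γ + 1) * c) * tanh (b * x) ^ 2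
      - (2 * γ + 3) * d * tanh (b * x) ^ 4) = 0 := by
  have hd : ∀ x, HasDerivAt
      (fun x => sechPow γ b x ^ 2 * ((c * tanh (b * x) + d * tanh (b * x) ^ 3) / b))
      (sechPow γ b x ^ 2 * (c + (3 * d - (2 * γ + 1) * c) * tanh (b * x) ^ 2
        - (2 * γ + 3) * d * tanh (b * x) ^ 4)) x := by
    intro x
    have ht := hasDerivAt_tanh_mul b x
    refine (((hasDerivAt_sechPow γ b x).fun_pow 2).mul
      (((ht.const_mul c).add ((ht.fun_pow 3).const_mul d)).div_const b)).congr_deriv ?_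
    simp only [Pi.add_apply]
    field_simp
    push_cast
    ring
  have i := integrable_sechPow_sq_mul_tanh hγ hb
  refine integral_eq_zero_of_hasDerivAt_of_integrable hd ?_ ?_
  · convert! (((i 0).const_mul c).add ((i 2).const_mul (3 * d - (2 * γ + 1) * c))).sub
      ((i 4).const_mul ((2 * γ + 3) * d)) using 2
    simp only [Pi.add_apply, Pi.sub_apply]
    ring
  · convert! ((i 1).const_mul (c / b)).add ((i 3).const_mul (d / b)) using 2
    simp only [Pi.add_apply]
    ring

lemma memLp_two_sechPow (hγ : 0 < γ) (hb : 0 < b) : MemLp (sechPow γ b) 2 :=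
  (memLp_two_iff_integrable_sq (continuous_sechPow γ b).aestronglyMeasurable).2
    (integrable_sechPow_sq hγ hb)

lemma profileSlope_primitive_eq (hγ : 0 < γ) (hb : 0 < b) :
    2 / (γ * b) * ∫ r in (0 : ℝ)..1, r * profileSlope γ r =
      2 / γ * ∫ x, sechPow γ b x ^ (2 + 4 / γ) := by
  have ct := continuous_tanh_mul b
  have cs := continuous_sechPow γ b
  have m1 : MemLp (fun x => -(γ * b * tanh (b * x) * sechPow γ b x)) 2 := by
    refine (memLp_two_iff_integrable_sq (by fun_prop)).2 ?_
    convert! (integrable_sechPow_sq_mul_tanh hγ hb 2).const_mul ((γ * b) ^ 2) using 2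
    ring
  obtain ⟨hi, h1, h2⟩ := integral_profileSlope hγ (x₀ := 0) (hasDerivAt_sechPow γ b)
    (fun x => (sechPow_pos γ b x).le) (by simp [sechPow]) (memLp_two_sechPow hγ hb) m1
  have hψ : ∀ x, profileSlope γ (sechPow γ b x) =
      4 * |tanh (b * x)| - 4 / 3 * |tanh (b * x)| ^ 3 := fun x => by
    rw [profileSlope, sechPow_rpow_two_div hγ, sub_sub_cancel, Real.sqrt_sq_eq_abs]
  set P : ℝ → ℝ := fun x => γ * b *
    (sechPow γ b x ^ 2 * (4 * tanh (b * x) ^ 2 - 4 / 3 * tanh (b * x) ^ 4)) with hP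
  have i := integrable_sechPow_sq_mul_tanh hγ hb
  have iP : Integrable P := by
    convert! (((i 2).const_mul 4).sub ((i 4).const_mul (4 / 3))).const_mul (γ * b) using 2
    simp only [hP, Pi.sub_apply]
    ring
  have iT : Integrable fun x => sechPow γ b x ^ 2 * (1 - tanh (b * x) ^ 2) ^ 2 := by
    convert! ((i 0).sub ((i 2).const_mul 2)).add (i 4) using 2
    simp only [Pi.add_apply, Pi.sub_apply]
    ring
  have e1 : ∫ x in Iic 0, P x = ∫ r in (0 : ℝ)..1, r * profileSlope γ r := by
    rw [← h1]
    refine setIntegral_congr_fun measurableSet_Iic fun x hx => ?_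
    have hT : tanh (b * x) ≤ 0 := by
      rw [tanh_eq_sinh_div_cosh]
      exact div_nonpos_of_nonpos_of_nonneg
        (sinh_nonpos_iff.2 (mul_nonpos_of_nonneg_of_nonpos hb.le hx)) (cosh_pos _).le
    simp only [hP, hψ, abs_of_nonpos hT]
    ring
  have e2 : ∫ x in Ioi 0, P x = ∫ r in (0 : ℝ)..1, r * profileSlope γ r := by
    rw [← neg_neg (∫ r in (0 : ℝ)..1, r * profileSlope γ r), ← h2, ← integral_neg]
    refine setIntegral_congr_fun measurableSet_Ioi fun x hx => ?_
    have hT : 0 ≤ tanh (b * x) := by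
      rw [tanh_eq_sinh_div_cosh]
      exact div_nonneg (sinh_nonneg_iff.2 (mul_nonneg hb.le (le_of_lt hx))) (cosh_pos _).le
    simp only [hP, hψ, abs_of_nonneg hT]
    ring
  have e3 : ∫ x, P x = 2 * ∫ r in (0 : ℝ)..1, r * profileSlope γ r := by
    rw [← intervalIntegral.integral_Iic_add_Ioi (b := 0) iP.integrableOn iP.integrableOn, e1, e2]
    ring
  have e4 := integral_sechPow_poly hγ hb (-2 / γ) (2 / (3 * γ))
  have e5 : (γ * b)⁻¹ * ∫ x, P x =
      2 / γ * ∫ x, sechPow γ b x ^ 2 * (1 - tanh (b * x) ^ 2) ^ 2 := by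
    rw [← sub_eq_zero, ← integral_const_mul, ← integral_const_mul,
      ← integral_sub (iP.const_mul _) (iT.const_mul _), ← e4]
    congr 1
    ext x
    simp only [hP]
    field_simp
    ring
  simp only [sechPow_rpow_critical hγ]
  rw [← e5, e3]
  field_simp

/-- The quadratic energy of the wave equals its critical integral. -/
lemma integral_sechPow_energy (hγ : 0 < γ) (hb : 0 < b) (hγb : b ^ 2 * (γ ^ 2 + (γ + 2) ^ 2) = 1) :
    ∫ x, ((b ^ 2 * (γ * (γ + 1) * tanh (b * x) ^ 2 - γ) * sechPow γ b x) ^ 2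
      + (-(γ * b * tanh (b * x) * sechPow γ b x)) ^ 2
      + b ^ 4 * γ ^ 2 * (γ + 2) ^ 2 * sechPow γ b x ^ 2) =
    b ^ 4 * (γ * (γ + 1) * (γ + 2) * (γ + 3)) * ∫ x, sechPow γ b x ^ (2 + 4 / γ) := by
  simp only [sechPow_rpow_critical hγ]
  have i := integrable_sechPow_sq_mul_tanh hγ hb
  have iT : Integrable fun x => sechPow γ b x ^ 2 * (1 - tanh (b * x) ^ 2) ^ 2 := by
    convert! ((i 0).sub ((i 2).const_mul 2)).add (i 4) using 2
    simp only [Pi.add_apply, Pi.sub_apply]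
    ring
  have e4 := integral_sechPow_poly hγ hb
    (b ^ 4 * (γ ^ 2 + γ ^ 2 * (γ + 2) ^ 2 - γ * (γ + 1) * (γ + 2) * (γ + 3)))
    (b ^ 4 * (γ * (γ + 1) * (γ + 2) * (γ + 3) - γ ^ 2 * (γ + 1) ^ 2) / (2 * γ + 3))
  have key : ∀ x, (b ^ 2 * (γ * (γ + 1) * tanh (b * x) ^ 2 - γ) * sechPow γ b x) ^ 2
      + (-(γ * b * tanh (b * x) * sechPow γ b x)) ^ 2
      + b ^ 4 * γ ^ 2 * (γ + 2) ^ 2 * sechPow γ b x ^ 2 =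
      b ^ 4 * (γ * (γ + 1) * (γ + 2) * (γ + 3)) *
        (sechPow γ b x ^ 2 * (1 - tanh (b * x) ^ 2) ^ 2) +
      sechPow γ b x ^ 2 *
        (b ^ 4 * (γ ^ 2 + γ ^ 2 * (γ + 2) ^ 2 - γ * (γ + 1) * (γ + 2) * (γ + 3)) +
          (3 * (b ^ 4 * (γ * (γ + 1) * (γ + 2) * (γ + 3) - γ ^ 2 * (γ + 1) ^ 2) / (2 * γ + 3)) -
            (2 * γ + 1) * (b ^ 4 * (γ ^ 2 + γ ^ 2 * (γ + 2) ^ 2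
              - γ * (γ + 1) * (γ + 2) * (γ + 3)))) * tanh (b * x) ^ 2 -
        (2 * γ + 3) * (b ^ 4 * (γ * (γ + 1) * (γ + 2) * (γ + 3) - γ ^ 2 * (γ + 1) ^ 2)
          / (2 * γ + 3)) * tanh (b * x) ^ 4) := by
    intro x
    have e : (-(γ * b * tanh (b * x) * sechPow γ b x)) ^ 2 =
        b ^ 2 * (γ ^ 2 + (γ + 2) ^ 2) * (γ * b * tanh (b * x) * sechPow γ b x) ^ 2 := by
      rw [hγb]; ring
    rw [e]
    field_simp
    ring
  simp only [key]
  rw [integral_add (iT.const_mul _) ?_, e4, integral_const_mul, add_zero]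
  convert! (((i 0).const_mul (b ^ 4 * (γ ^ 2 + γ ^ 2 * (γ + 2) ^ 2
      - γ * (γ + 1) * (γ + 2) * (γ + 3)))).add
    ((i 2).const_mul (3 * (b ^ 4 * (γ * (γ + 1) * (γ + 2) * (γ + 3) - γ ^ 2 * (γ + 1) ^ 2)
      / (2 * γ + 3)) - (2 * γ + 1) * (b ^ 4 * (γ ^ 2 + γ ^ 2 * (γ + 2) ^ 2
      - γ * (γ + 1) * (γ + 2) * (γ + 3)))))).sub
    ((i 4).const_mul ((2 * γ + 3) * (b ^ 4 * (γ * (γ + 1) * (γ + 2) * (γ + 3)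
      - γ ^ 2 * (γ + 1) ^ 2) / (2 * γ + 3)))) using 2
  simp only [Pi.add_apply, Pi.sub_apply]
  ring

end Wave

section Energy

/-- A sharp lower bound for the quadratic energy of a normalised positive profile whose
logarithmic derivative is bounded by `γ b`. -/
lemma energy_ge {γ b : ℝ} (hγ : 0 < γ) (hb : 0 < b) (hγb : b ^ 2 * (γ ^ 2 + (γ + 2) ^ 2) = 1)
    {s s₁ s₂ : ℝ → ℝ} {x₀ : ℝ} (hs : ∀ x, HasDerivAt s (s₁ x) x)
    (hs₁ : ∀ x, HasDerivAt s₁ (s₂ x) x) (h0 : ∀ x, 0 < s x) (h1 : ∀ x, s x ≤ 1)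
    (hx₀ : s x₀ = 1) (hκ : ∀ x, |s₁ x| ≤ γ * b * s x)
    (ms : MemLp s 2) (ms₁ : MemLp s₁ 2) (ms₂ : MemLp s₂ 2) :
    b ^ 4 * γ ^ 2 * ((γ + 1) * (γ + 3)) *
        ((∫ x, s x ^ (2 + 4 / γ)) + 2 / γ * ∫ x, sechPow γ b x ^ (2 + 4 / γ)) ≤
      ∫ x, (s₂ x ^ 2 + s₁ x ^ 2 + b ^ 4 * γ ^ 2 * (γ + 2) ^ 2 * s x ^ 2) := by
  have hκ0 : 0 < γ * b := by positivity
  obtain ⟨iP, hP⟩ := integral_profile_ge hγ hκ0 hs h0 h1 hx₀ hκ ms ms₁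
  rw [profileSlope_primitive_eq hγ hb] at hP
  have cs := continuous_of_forall_hasDerivAt hs
  have cs₁ := continuous_of_forall_hasDerivAt hs₁
  set q : ℝ → ℝ := fun x => s₁ x ^ 2 / s x with hq
  have mq : MemLp q 2 := by
    refine (ms₁.const_mul (γ * b)).mono
      ((cs₁.pow 2).div cs fun x => (h0 x).ne').aestronglyMeasurable (ae_of_all _ fun x => ?_)
    rw [Real.norm_eq_abs, Real.norm_eq_abs, abs_mul, abs_of_pos hκ0, hq, abs_div, abs_pow,
      abs_of_pos (h0 x), div_le_iff₀ (h0 x)]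
    calc |s₁ x| ^ 2 = |s₁ x| * |s₁ x| := sq _
      _ ≤ |s₁ x| * (γ * b * s x) := by gcongr; exact hκ x
      _ = _ := by ring
  set A : ℝ := 2 * (γ + 1) / (3 * γ) with hA
  set D : ℝ → ℝ := fun x => A * (3 * (q x * s₂ x) - q x ^ 2)
    - 2 * γ * b ^ 2 * (s₁ x ^ 2 + s x * s₂ x) with hD
  have hF : ∀ x, HasDerivAt (fun x => A * (s₁ x * q x) - 2 * γ * b ^ 2 * (s x * s₁ x)) (D x) x := by
    intro x
    have hq' : HasDerivAt q _ x := ((hs₁ x).fun_pow 2).div (hs x) (h0 x).ne'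
    refine ((((hs₁ x).mul hq').const_mul A).sub
      (((hs x).mul (hs₁ x)).const_mul (2 * γ * b ^ 2))).congr_deriv ?_
    have := (h0 x).ne'
    simp only [hD, hq]
    field_simp
    push_cast
    ring
  have iD : Integrable D := by
    refine ((((mq.integrable_mul ms₂).const_mul 3).sub mq.integrable_sq).const_mul A).sub
      ((ms₁.integrable_sq.add (ms.integrable_mul ms₂)).const_mul (2 * γ * b ^ 2))
  have hD0 : ∫ x, D x = 0 := integral_eq_zero_of_hasDerivAt_of_integrable hF iD
    (((ms₁.integrable_mul mq).const_mul A).sub ((ms.integrable_mul ms₁).const_mul (2 * γ * b ^ 2)))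
  set K : ℝ := b ^ 4 * γ ^ 2 * ((γ + 1) * (γ + 3)) with hK
  have hKP : K * ∫ x, s x ^ 2 *
      (1 + 2 * (s₁ x / (γ * b * s x)) ^ 2 - (s₁ x / (γ * b * s x)) ^ 4 / 3) ≤
      ∫ x, (s₂ x ^ 2 + s₁ x ^ 2 + b ^ 4 * γ ^ 2 * (γ + 2) ^ 2 * s x ^ 2) := by
    rw [← add_zero (K * _), ← hD0, ← integral_const_mul, ← integral_add (iP.const_mul K) iD]
    refine integral_mono ((iP.const_mul K).add iD) ((ms₂.integrable_sq.add ms₁.integrable_sq).add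
      (ms.integrable_sq.const_mul _)) fun x => ?_
    have hsx := (h0 x).ne'
    have e : s₂ x ^ 2 + s₁ x ^ 2 + b ^ 4 * γ ^ 2 * (γ + 2) ^ 2 * s x ^ 2 - (K * (s x ^ 2 *
        (1 + 2 * (s₁ x / (γ * b * s x)) ^ 2 - (s₁ x / (γ * b * s x)) ^ 4 / 3)) + D x) =
        (s₂ x - ((γ + 1) / γ * q x - γ * b ^ 2 * s x)) ^ 2
        + (1 - b ^ 2 * (γ ^ 2 + (γ + 2) ^ 2)) * s₁ x ^ 2 := by
      simp only [hK, hD, hA, hq]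
      field_simp
      ring
    rw [hγb, sub_self, zero_mul, add_zero] at e
    have := sq_nonneg (s₂ x - ((γ + 1) / γ * q x - γ * b ^ 2 * s x))
    simp only
    linarith
  refine le_trans ?_ hKP
  gcongr

/-- A nonnegative function with bounded logarithmic derivative vanishes identically or nowhere. -/
lemma eq_zero_or_pos_of_abs_deriv_le {κ : ℝ} {v v₁ : ℝ → ℝ} (hv : ∀ x, HasDerivAt v (v₁ x) x)
    (h : ∀ x, |v₁ x| ≤ κ * v x) (h0 : ∀ x, 0 ≤ v x) : (∀ x, v x = 0) ∨ ∀ x, 0 < v x := by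
  by_contra! hc
  obtain ⟨⟨y, hy⟩, z, hz⟩ := hc
  have hz0 : v z = 0 := le_antisymm hz (h0 z)
  have hy0 : 0 < v y := lt_of_le_of_ne (h0 y) hy.symm
  have key : ∀ c : ℝ, ∀ x, HasDerivAt (fun x => exp (c * x) * v x)
      (exp (c * x) * (c * v x + v₁ x)) x := fun c x => by
    have hl : HasDerivAt (fun x => c * x) c x := by simpa using (hasDerivAt_id x).const_mul c
    exact (hl.exp.mul (hv x)).congr_deriv (by ring)
  rcases le_total y z with hyz | hyz
  · have mono : Monotone fun x => exp (κ * x) * v x :=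
      monotone_of_hasDerivAt_nonneg (key κ) fun x => by
        have := (abs_le.1 (h x)).1
        exact mul_nonneg (exp_pos _).le (by linarith)
    have := mono hyz
    simp only [hz0, mul_zero] at this
    exact absurd this (not_le.2 (mul_pos (exp_pos _) hy0))
  · have anti : Antitone fun x => exp (-κ * x) * v x :=
      antitone_of_hasDerivAt_nonpos (key (-κ)) fun x => by
        have := (abs_le.1 (h x)).2
        exact mul_nonpos_of_nonneg_of_nonpos (exp_pos _).le (by linarith)
    have := anti hyz
    simp only [hz0, mul_zero] at this
    exact absurd this (not_le.2 (mul_pos (exp_pos _) hy0))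

end Energy

section Duality

lemma integral_pos_of_forall_pos {f : ℝ → ℝ} (hf : Integrable f) (h : ∀ x, 0 < f x) :
    0 < ∫ x, f x := by
  rw [integral_pos_iff_support_of_nonneg (fun x => (h x).le) hf]
  have : Function.support f = univ := eq_univ_of_forall fun x => (h x).ne'
  simp [this]

lemma integrable_sechPow_critical {γ b : ℝ} (hγ : 0 < γ) (hb : 0 < b) :
    Integrable fun x => sechPow γ b x ^ (2 + 4 / γ) := by
  simp only [sechPow_rpow_critical hγ]
  have i := integrable_sechPow_sq_mul_tanh hγ hb
  convert! ((i 0).sub ((i 2).const_mul 2)).add (i 4) using 2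
  simp only [Pi.add_apply, Pi.sub_apply]
  ring

/-- Homogeneous lower bound for the quadratic energy in terms of the critical mass. -/
lemma energy_ge_sq_mul {γ b a y : ℝ} (hγ : 0 < γ) (hb : 0 < b)
    (hγb : b ^ 2 * (γ ^ 2 + (γ + 2) ^ 2) = 1) (ha : 0 < a)
    (haγ : a ^ (4 / γ) = b ^ 4 * (γ * (γ + 1) * (γ + 2) * (γ + 3)))
    {v v₁ v₂ : ℝ → ℝ} (hv : ∀ x, HasDerivAt v (v₁ x) x) (hv₁ : ∀ x, HasDerivAt v₁ (v₂ x) x)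
    (h0 : ∀ x, 0 < v x) (hκ : ∀ x, |v₁ x| ≤ γ * b * v x)
    (mv : MemLp v 2) (mv₁ : MemLp v₁ 2) (mv₂ : MemLp v₂ 2) (hy0 : 0 < y)
    (hY : ∫ x, v x ^ (2 + 4 / γ) =
      y ^ (2 + 4 / γ) * (a ^ (2 + 4 / γ) * ∫ x, sechPow γ b x ^ (2 + 4 / γ))) :
    y ^ 2 * (a ^ (2 + 4 / γ) * ∫ x, sechPow γ b x ^ (2 + 4 / γ)) ≤
      ∫ x, (v₂ x ^ 2 + v₁ x ^ 2 + b ^ 4 * γ ^ 2 * (γ + 2) ^ 2 * v x ^ 2) := by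
  obtain ⟨x₀, hx₀⟩ := exists_forall_norm_le hv mv mv₁
  have hmax : ∀ x, v x ≤ v x₀ := fun x => by
    have := hx₀ x
    rwa [norm_of_nonneg (h0 x).le, norm_of_nonneg (h0 x₀).le] at this
  set m := v x₀ with hm
  have hm0 : 0 < m := h0 x₀
  have hE := energy_ge hγ hb hγb (s := fun x => m⁻¹ * v x) (fun x => (hv x).const_mul m⁻¹)
    (fun x => (hv₁ x).const_mul m⁻¹) (fun x => mul_pos (inv_pos.2 hm0) (h0 x))
    (fun x => by rw [inv_mul_le_iff₀ hm0, mul_one]; exact hmax x)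
    (x₀ := x₀) (inv_mul_cancel₀ hm0.ne')
    (fun x => by
      rw [abs_mul, abs_of_pos (inv_pos.2 hm0), mul_left_comm]
      gcongr
      exact hκ x)
    (mv.const_mul _) (mv₁.const_mul _) (mv₂.const_mul _)
  set p : ℝ := 2 + 4 / γ with hp
  have hp2 : 2 ≤ p := by
    have : 0 < 4 / γ := by positivity
    linarith
  have hp0 : 0 < p := by linarith
  set τ₁ := ∫ x, sechPow γ b x ^ p with hτ₁
  have hτ₁0 : 0 ≤ τ₁ := integral_nonneg fun x => rpow_nonneg (sechPow_pos γ b x).le _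
  have e1 : ∫ x, (m⁻¹ * v x) ^ p = (y * a / m) ^ p * τ₁ := by
    have (x : ℝ) : (m⁻¹ * v x) ^ p = (m ^ p)⁻¹ * v x ^ p := by
      rw [mul_rpow (inv_pos.2 hm0).le (h0 x).le, inv_rpow hm0.le]
    simp only [this]
    rw [integral_const_mul, hY, div_rpow (by positivity) hm0.le, mul_rpow hy0.le ha.le]
    ring
  set W := ∫ x, (v₂ x ^ 2 + v₁ x ^ 2 + b ^ 4 * γ ^ 2 * (γ + 2) ^ 2 * v x ^ 2) with hW
  have e2 : ∫ x, ((m⁻¹ * v₂ x) ^ 2 + (m⁻¹ * v₁ x) ^ 2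
      + b ^ 4 * γ ^ 2 * (γ + 2) ^ 2 * (m⁻¹ * v x) ^ 2) = (m ^ 2)⁻¹ * W := by
    rw [hW, ← integral_const_mul]
    congr 1
    ext x
    field_simp
  rw [e1, e2] at hE
  have hk0 : 0 < y * a / m := by positivity
  have hamgm : (y * a / m) ^ 2 ≤ 2 / p * (y * a / m) ^ p + (1 - 2 / p) := by
    have := Real.geom_mean_le_arith_mean2_weighted (w₁ := 2 / p) (w₂ := 1 - 2 / p)
      (p₁ := (y * a / m) ^ p) (p₂ := 1) (by positivity)
      (sub_nonneg.2 ((div_le_one hp0).2 hp2)) (by positivity) zero_le_one (by ring)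
    rwa [← rpow_mul hk0.le, mul_div_cancel₀ _ hp0.ne', rpow_two, one_rpow, mul_one, mul_one]
      at this
  have hpγ : 2 / p = γ / (γ + 2) := by
    rw [hp]
    field_simp
    ring
  have e4 : b ^ 4 * γ ^ 2 * ((γ + 1) * (γ + 3)) * ((y * a / m) ^ p * τ₁ + 2 / γ * τ₁) =
      a ^ (4 / γ) * τ₁ * (2 / p * (y * a / m) ^ p + (1 - 2 / p)) := by
    rw [haγ, hpγ]
    field_simp
    ring
  rw [e4] at hE
  calc y ^ 2 * (a ^ p * τ₁) = m ^ 2 * (a ^ (4 / γ) * τ₁ * (y * a / m) ^ 2) := by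
        rw [hp, rpow_add ha, rpow_two]
        field_simp
    _ ≤ m ^ 2 * (a ^ (4 / γ) * τ₁ * (2 / p * (y * a / m) ^ p + (1 - 2 / p))) := by gcongr
    _ ≤ m ^ 2 * ((m ^ 2)⁻¹ * W) := mul_le_mul_of_nonneg_left hE (sq_nonneg m)
    _ = W := by field_simp

lemma integral_rpow_mul_le {p y : ℝ} (hp : 1 ≤ p) (hy0 : 0 < y) {h v : ℝ → ℝ}
    (hh : ∀ x, 0 ≤ h x) (h0 : ∀ x, 0 ≤ v x) (ih : Integrable fun x => h x ^ p)
    (iv : Integrable fun x => v x ^ p) (ihv : Integrable fun x => h x ^ (p - 1) * v x)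
    (hY : ∫ x, v x ^ p = y ^ p * ∫ x, h x ^ p) :
    ∫ x, h x ^ (p - 1) * v x ≤ y * ∫ x, h x ^ p := by
  have hp0 : 0 < p := by linarith
  have hpt : ∀ x, h x ^ (p - 1) * v x ≤
      y * ((1 - 1 / p) * h x ^ p + 1 / p * (v x ^ p / y ^ p)) := fun x => by
    have := Real.geom_mean_le_arith_mean2_weighted (w₁ := 1 - 1 / p) (w₂ := 1 / p)
      (p₁ := h x ^ p) (p₂ := (v x / y) ^ p)
      (sub_nonneg.2 ((div_le_one hp0).2 hp)) (by positivity)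
      (rpow_nonneg (hh x) _) (rpow_nonneg (div_nonneg (h0 x) hy0.le) _) (by ring)
    rw [← rpow_mul (hh x), ← rpow_mul (div_nonneg (h0 x) hy0.le), mul_one_div_cancel hp0.ne',
      rpow_one, mul_sub, mul_one, mul_one_div_cancel hp0.ne', div_rpow (h0 x) hy0.le] at this
    calc h x ^ (p - 1) * v x = y * (h x ^ (p - 1) * (v x / y)) := by field_simp
      _ ≤ _ := by gcongr
  have i2 := (ih.const_mul (1 - 1 / p)).add ((iv.div_const (y ^ p)).const_mul (1 / p))
  refine (integral_mono ihv (i2.const_mul y) hpt).trans_eq ?_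
  simp only [Pi.add_apply]
  have hyp : 0 < y ^ p := rpow_pos_of_pos hy0 p
  rw [integral_const_mul, integral_add (ih.const_mul _) ((iv.div_const _).const_mul _),
    integral_const_mul, integral_const_mul, integral_div, hY]
  field_simp
  ring

/-- If `h` has the critical mass of the wave, then the dual energy of `h ^ (p - 1)`
does not exceed that mass. -/
lemma dual_energy_le {γ b a : ℝ} (hγ : 0 < γ) (hb : 0 < b)
    (hγb : b ^ 2 * (γ ^ 2 + (γ + 2) ^ 2) = 1) (ha : 0 < a)
    (haγ : a ^ (4 / γ) = b ^ 4 * (γ * (γ + 1) * (γ + 2) * (γ + 3)))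
    {v v₁ v₂ h : ℝ → ℝ} (hv : ∀ x, HasDerivAt v (v₁ x) x) (hv₁ : ∀ x, HasDerivAt v₁ (v₂ x) x)
    (h0 : ∀ x, 0 ≤ v x) (hκ : ∀ x, |v₁ x| ≤ γ * b * v x)
    (mv : MemLp v 2) (mv₁ : MemLp v₁ 2) (mv₂ : MemLp v₂ 2)
    (hh : ∀ x, 0 ≤ h x) (ih : Integrable fun x => h x ^ (2 + 4 / γ))
    (ihv : Integrable fun x => h x ^ (2 + 4 / γ - 1) * v x)
    (hmass : ∫ x, h x ^ (2 + 4 / γ) =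
      a ^ (2 + 4 / γ) * ∫ x, sechPow γ b x ^ (2 + 4 / γ))
    (hW : ∫ x, (v₂ x ^ 2 + v₁ x ^ 2 + b ^ 4 * γ ^ 2 * (γ + 2) ^ 2 * v x ^ 2) =
      ∫ x, h x ^ (2 + 4 / γ - 1) * v x) :
    ∫ x, h x ^ (2 + 4 / γ - 1) * v x ≤ ∫ x, h x ^ (2 + 4 / γ) := by
  rcases eq_zero_or_pos_of_abs_deriv_le hv hκ h0 with hz | hpos
  · simp only [hz, mul_zero, integral_zero]
    exact integral_nonneg fun x => rpow_nonneg (hh x) _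
  have low := fun y => energy_ge_sq_mul (y := y) hγ hb hγb ha haγ hv hv₁ hpos hκ mv mv₁ mv₂
  rw [hW, ← hmass] at low
  obtain ⟨x₀, hx₀⟩ := exists_forall_norm_le hv mv mv₁
  have hτ₁0 : 0 < ∫ x, sechPow γ b x ^ (2 + 4 / γ) :=
    integral_pos_of_forall_pos (integrable_sechPow_critical hγ hb)
      fun x => rpow_pos_of_pos (sechPow_pos γ b x) _
  have hτ0 : 0 < ∫ x, h x ^ (2 + 4 / γ) := by rw [hmass]; positivity
  have hp2 : 2 ≤ 2 + 4 / γ := le_add_of_nonneg_right (by positivity)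
  have iv : Integrable fun x => v x ^ (2 + 4 / γ) := by
    have := integrable_norm_rpow_of_memLp_two mv hx₀ hp2
    simpa only [norm_of_nonneg (h0 _)] using this
  have hY0 : 0 < ∫ x, v x ^ (2 + 4 / γ) :=
    integral_pos_of_forall_pos iv fun x => rpow_pos_of_pos (hpos x) _
  have up := fun y hy => integral_rpow_mul_le (y := y) (by linarith) hy hh h0 ih iv ihv
  generalize 2 + 4 / γ = p at *
  generalize ∫ x, h x ^ (p - 1) * v x = W at *
  generalize ∫ x, h x ^ p = τ at *
  generalize ∫ x, v x ^ p = Y at *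
  have hy0 : 0 < (Y / τ) ^ (1 / p) := by positivity
  have hyp : Y = ((Y / τ) ^ (1 / p)) ^ p * τ := by
    rw [← rpow_mul (by positivity), one_div_mul_cancel (by positivity), rpow_one]
    field_simp
  have l := low _ hy0 hyp
  have u := up _ hy0 hyp
  generalize (Y / τ) ^ (1 / p) = y at *
  have hy1 : y ≤ 1 := by
    by_contra! hc
    nlinarith [mul_pos hy0 hτ0]
  nlinarith

end Duality

section Minimality

variable {E : Type*} [NormedAddCommGroup E]

lemma integrable_norm_sq_of_memLp_two {f : ℝ → E} (hf : MemLp f 2) :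
    Integrable fun x => ‖f x‖ ^ 2 :=
  (memLp_two_iff_integrable_sq_norm hf.aestronglyMeasurable).1 hf

lemma memLp_two_of_norm_le {f : ℝ → E} (hf : Continuous f) {c : ℝ} {g : ℝ → ℝ} (hg : MemLp g 2)
    (h : ∀ x, ‖f x‖ ≤ c * g x) : MemLp f 2 :=
  (hg.const_mul c).mono hf.aestronglyMeasurable
    (ae_of_all _ fun x => (h x).trans (le_abs_self _))

/-- A function with the critical mass of the wave has energy at least that mass. -/
lemma mass_le_energy [InnerProductSpace ℝ E] [CompleteSpace E] {γ b a : ℝ} (hγ : 0 < γ) (hb : 0 < b)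
    (hγb : b ^ 2 * (γ ^ 2 + (γ + 2) ^ 2) = 1) (ha : 0 < a)
    (haγ : a ^ (4 / γ) = b ^ 4 * (γ * (γ + 1) * (γ + 2) * (γ + 3)))
    {u u₁ u₂ : ℝ → E} (hu : ∀ x, HasDerivAt u (u₁ x) x) (hu₁ : ∀ x, HasDerivAt u₁ (u₂ x) x)
    (mu : MemLp u 2) (mu₁ : MemLp u₁ 2) (mu₂ : MemLp u₂ 2)
    (hmass : ∫ x, ‖u x‖ ^ (2 + 4 / γ) =
      a ^ (2 + 4 / γ) * ∫ x, sechPow γ b x ^ (2 + 4 / γ)) :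
    ∫ x, ‖u x‖ ^ (2 + 4 / γ) ≤
      ∫ x, (‖u₂ x‖ ^ 2 + ‖u₁ x‖ ^ 2 + b ^ 4 * γ ^ 2 * (γ + 2) ^ 2 * ‖u x‖ ^ 2) := by
  obtain ⟨x₀, hx₀⟩ := exists_forall_norm_le hu mu mu₁
  have hq : 0 < 4 / γ := by positivity
  have hp1 : 2 + 4 / γ - 1 = 4 / γ + 1 := by ring
  have cu := continuous_of_forall_hasDerivAt hu
  set f : ℝ → E := fun x => ‖u x‖ ^ (4 / γ) • u x with hf
  set g : ℝ → ℝ := fun x => ‖u x‖ ^ (2 + 4 / γ - 1) with hg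
  have cf : Continuous f := (cu.norm.rpow_const fun _ => Or.inr hq.le).smul cu
  have cg : Continuous g := cu.norm.rpow_const fun _ => Or.inr (by linarith)
  have hfg : ∀ x, ‖f x‖ = g x := fun x => by
    simp only [hf, hg]
    rw [norm_smul, norm_of_nonneg (rpow_nonneg (norm_nonneg _) _), hp1,
      rpow_add_one' (norm_nonneg _) (by linarith)]
  have hg0 : ∀ x, 0 ≤ g x := fun x => rpow_nonneg (norm_nonneg _) _
  have mf : MemLp f 2 := memLp_two_of_norm_le cf mu.norm (c := ‖u x₀‖ ^ (4 / γ)) fun x => by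
    simp only [hf]
    rw [norm_smul, norm_of_nonneg (rpow_nonneg (norm_nonneg _) _)]
    gcongr
    exact hx₀ x
  have mg : MemLp g 2 := mf.norm.congr_norm cg.aestronglyMeasurable
    (ae_of_all _ fun x => by rw [norm_norm, hfg, norm_of_nonneg (hg0 x)])
  have hm₁ : 0 < (γ + 2) * b := by positivity
  have hm₂ : 0 < γ * b := by positivity
  obtain ⟨F, F₁, G, G₁, hF, hF₁, hG, hG₁, nF, nF₁, nG₁, bG⟩ := exists_resolvent hm₁ cf cg
    (fun x => (hfg x).le) (C := ‖u x₀‖ ^ (2 + 4 / γ - 1))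
    fun x => rpow_le_rpow (norm_nonneg _) (hx₀ x) (by linarith)
  have cF := continuous_of_forall_hasDerivAt hF
  have cG := continuous_of_forall_hasDerivAt hG
  obtain ⟨V, V₁, v, v₁, hV, hV₁, hv, hv₁, nV, nV₁, nv₁, bv⟩ := exists_resolvent hm₂ cF cG nF bG
  have h0G : ∀ x, 0 ≤ G x := fun x => (norm_nonneg _).trans (nF x)
  have h0v : ∀ x, 0 ≤ v x := fun x => (norm_nonneg _).trans (nV x)
  have mG : MemLp G 2 := memLp_two_resolvent hm₁ cg mg hG hG₁ h0G nG₁ bG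
  have mG₁ : MemLp G₁ 2 := memLp_two_of_norm_le (continuous_of_forall_hasDerivAt hG₁) mG nG₁
  have mF : MemLp F 2 := memLp_two_of_norm_le cF mG (c := 1) (by simpa using nF)
  have mF₁ : MemLp F₁ 2 := memLp_two_of_norm_le (continuous_of_forall_hasDerivAt hF₁) mG nF₁
  have mv : MemLp v 2 := memLp_two_resolvent hm₂ cG mG hv hv₁ h0v nv₁ bv
  have mv₁ : MemLp v₁ 2 := memLp_two_of_norm_le (continuous_of_forall_hasDerivAt hv₁) mv nv₁
  have mV : MemLp V 2 :=
    memLp_two_of_norm_le (continuous_of_forall_hasDerivAt hV) mv (c := 1) (by simpa using nV)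
  have mV₁ : MemLp V₁ 2 := memLp_two_of_norm_le (continuous_of_forall_hasDerivAt hV₁) mv nV₁
  have mV₂ : MemLp (fun x => (γ * b) ^ 2 • V x - F x) 2 := (mV.const_smul _).sub mF
  have mv₂ : MemLp (fun x => (γ * b) ^ 2 * v x - G x) 2 := (mv.const_mul _).sub mG
  have hμ : ((γ + 2) * b) ^ 2 + (γ * b) ^ 2 = 1 := by rw [← hγb]; ring
  have hω : ((γ + 2) * b) ^ 2 * (γ * b) ^ 2 = b ^ 4 * γ ^ 2 * (γ + 2) ^ 2 := by ring
  set ω := b ^ 4 * γ ^ 2 * (γ + 2) ^ 2 with hωdef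
  have hω0 : 0 ≤ ω := by positivity
  have dual := integral_inner_biresolvent hμ hv hv₁ hv hv₁ hG hG₁ mv mv₁ mv₂ mv mv₁ mG mG₁ mg
  have dualV := integral_inner_biresolvent hμ hV hV₁ hV hV₁ hF hF₁ mV mV₁ mV₂ mV mV₁ mF mF₁ mf
  have test := integral_inner_biresolvent hμ hu hu₁ hV hV₁ hF hF₁ mu mu₁ mu₂ mV mV₁ mF mF₁ mf
  rw [hω] at dual dualV test
  simp only [real_inner_self_eq_norm_sq] at dualV
  simp only [smul_eq_mul, RCLike.inner_apply, conj_trivial, ← sq] at dual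
  have igv : Integrable fun x => g x * v x := mg.integrable_mul mv
  have ie : ∀ {w w₁ w₂ : ℝ → E}, MemLp w 2 → MemLp w₁ 2 → MemLp w₂ 2 →
      Integrable fun x => ‖w₂ x‖ ^ 2 + ‖w₁ x‖ ^ 2 + ω * ‖w x‖ ^ 2 := fun a0 a1 a2 =>
    ((integrable_norm_sq_of_memLp_two a2).add (integrable_norm_sq_of_memLp_two a1)).add
      ((integrable_norm_sq_of_memLp_two a0).const_mul ω)
  have hpw : ∀ x, inner ℝ (u x) (f x) = ‖u x‖ ^ (2 + 4 / γ) := fun x => by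
    simp only [hf]
    rw [inner_smul_right, real_inner_self_eq_norm_sq, ← rpow_two,
      ← rpow_add_of_nonneg (norm_nonneg _) hq.le (by norm_num), add_comm]
  have c1 : ∫ x, g x * v x ≤ ∫ x, ‖u x‖ ^ (2 + 4 / γ) :=
    dual_energy_le hγ hb hγb ha haγ hv hv₁ h0v nv₁ mv mv₁ mv₂ (fun x => norm_nonneg (u x))
      (integrable_norm_rpow_of_memLp_two mu hx₀ (by linarith)) igv hmass dual.symm
  have c2 : ∫ x, inner ℝ (V x) (f x) ≤ ∫ x, g x * v x :=
    integral_mono (integrable_inner_of_memLp_two mV mf) igv fun x => by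
      calc inner ℝ (V x) (f x) ≤ ‖V x‖ * ‖f x‖ := real_inner_le_norm _ _
        _ ≤ v x * g x := by
            rw [hfg]
            exact mul_le_mul_of_nonneg_right (nV x) (hg0 x)
        _ = g x * v x := mul_comm _ _
  have young : ∀ y z : E, inner ℝ y z ≤ 2⁻¹ * (‖y‖ ^ 2 + ‖z‖ ^ 2) := fun y z => by
    nlinarith [real_inner_le_norm y z, sq_nonneg (‖y‖ - ‖z‖)]
  have I := fun {f g : ℝ → E} (hf : MemLp f 2) (hg : MemLp g 2) =>
    integrable_inner_of_memLp_two hf hg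
  have c3 : ∫ x, ‖u x‖ ^ (2 + 4 / γ) ≤
      2⁻¹ * ((∫ x, (‖u₂ x‖ ^ 2 + ‖u₁ x‖ ^ 2 + ω * ‖u x‖ ^ 2)) + ∫ x, inner ℝ (V x) (f x)) := by
    simp only [hpw] at test
    rw [test, dualV, ← integral_add (ie mu mu₁ mu₂) (ie mV mV₁ mV₂), ← integral_const_mul]
    refine integral_mono (((I mu₂ mV₂).add (I mu₁ mV₁)).add ((I mu mV).const_mul ω))
      (((ie mu mu₁ mu₂).add (ie mV mV₁ mV₂)).const_mul _) fun x => ?_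
    have y0 := mul_le_mul_of_nonneg_left (young (u x) (V x)) hω0
    have y1 := young (u₁ x) (V₁ x)
    have y2 := young (u₂ x) ((γ * b) ^ 2 • V x - F x)
    simp only
    linarith
  linarith

end Minimality

end SolitaryWave

/-- The explicit solitary wave `φ` is a minimizer of the constrained problem
`Γ_{ω₀,τ₀}`: every admissible `u` with `∫|u|^{α+2} = τ₀` satisfies
`𝓑_{ω₀}(u) ≥ 𝓑_{ω₀}(φ) = τ₀/2`. -/
theorem explicit_wave_is_minimizer (α : ℝ) (hα : 0 < α)
    (a₀ b₀ ω₀ : ℝ)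
    (ha : a₀ = ((3*α^3 + 22*α^2 + 48*α + 32) / (2*(α^2 + 4*α + 8)^2)) ^ (1/α))
    (hb : b₀ = α / (2 * Real.sqrt (α^2 + 4*α + 8)))
    (hω : ω₀ = 4*(α^2 + 4*α + 4) / (α^4 + 8*α^3 + 32*α^2 + 64*α + 64))
    (φ : ℝ → ℝ)
    (hφ : ∀ x, φ x = a₀ * (Real.cosh (b₀ * x))⁻¹ ^ ((4:ℝ)/α))
    (τ₀ : ℝ) (hτ : τ₀ = ∫ x : ℝ, φ x ^ (α + 2)) :
    (1/2) * (∫ x : ℝ, ((iteratedDeriv 2 φ x)^2 + (deriv φ x)^2 + ω₀ * (φ x)^2))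
      = τ₀ / 2 ∧
    ∀ u : ℝ → ℂ, ContDiff ℝ 2 u →
      Integrable (fun x => ‖u x‖^2) →
      Integrable (fun x => ‖deriv u x‖^2) →
      Integrable (fun x => ‖iteratedDeriv 2 u x‖^2) →
      (∫ x : ℝ, ‖u x‖ ^ (α + 2)) = τ₀ →
      τ₀ / 2 ≤ (1/2) * ∫ x : ℝ, (‖iteratedDeriv 2 u x‖^2 + ‖deriv u x‖^2
        + ω₀ * ‖u x‖^2) := by
  set γ : ℝ := 4 / α with hγdef
  have hγ : 0 < γ := by positivity
  have hγα : 4 / γ = α := by rw [hγdef]; field_simp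
  have hD : 0 < α ^ 2 + 4 * α + 8 := by positivity
  have hb0 : 0 < b₀ := by rw [hb]; positivity
  have hb2 : b₀ ^ 2 = α ^ 2 / (4 * (α ^ 2 + 4 * α + 8)) := by
    rw [hb, div_pow, mul_pow, Real.sq_sqrt hD.le]
    norm_num
  have hb4 : b₀ ^ 4 = (α ^ 2 / (4 * (α ^ 2 + 4 * α + 8))) ^ 2 := by rw [← hb2]; ring
  have hγb : b₀ ^ 2 * (γ ^ 2 + (γ + 2) ^ 2) = 1 := by
    rw [hb2, hγdef]
    field_simp
    ring
  have ha0 : 0 < a₀ := by rw [ha]; positivity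
  have haγ : a₀ ^ (4 / γ) = b₀ ^ 4 * (γ * (γ + 1) * (γ + 2) * (γ + 3)) := by
    rw [hγα, ha, ← rpow_mul (by positivity), one_div_mul_cancel hα.ne', rpow_one, hb4, hγdef]
    field_simp
    ring
  have hω' : ω₀ = b₀ ^ 4 * γ ^ 2 * (γ + 2) ^ 2 := by
    have e : α ^ 4 + 8 * α ^ 3 + 32 * α ^ 2 + 64 * α + 64 = (α ^ 2 + 4 * α + 8) ^ 2 := by ring
    rw [hω, e, hb4, hγdef]
    field_simp
    ring
  have hp : α + 2 = 2 + 4 / γ := by rw [hγα, add_comm]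
  have hφ' : φ = fun x => a₀ * SolitaryWave.sechPow γ b₀ x := funext hφ
  have hτ' : τ₀ = a₀ ^ (2 + 4 / γ) * ∫ x, SolitaryWave.sechPow γ b₀ x ^ (2 + 4 / γ) := by
    rw [hτ, hp, ← integral_const_mul, hφ']
    congr 1
    ext x
    exact mul_rpow ha0.le (SolitaryWave.sechPow_pos _ _ _).le
  refine ⟨?_, fun u hu i0 i1 i2 hm => ?_⟩
  · have d1 : deriv φ =
        fun x => a₀ * -(γ * b₀ * tanh (b₀ * x) * SolitaryWave.sechPow γ b₀ x) := by
      ext x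
      rw [hφ']
      exact ((SolitaryWave.hasDerivAt_sechPow γ b₀ x).const_mul a₀).deriv
    have d2 : iteratedDeriv 2 φ = fun x => a₀ * (b₀ ^ 2 *
        (γ * (γ + 1) * tanh (b₀ * x) ^ 2 - γ) * SolitaryWave.sechPow γ b₀ x) := by
      rw [iteratedDeriv_succ, iteratedDeriv_one, d1]
      ext x
      refine (((((SolitaryWave.hasDerivAt_tanh_mul b₀ x).const_mul (γ * b₀)).mul
        (SolitaryWave.hasDerivAt_sechPow γ b₀ x)).neg).const_mul a₀).deriv.trans ?_
      ring
    have e (x : ℝ) : iteratedDeriv 2 φ x ^ 2 + deriv φ x ^ 2 + ω₀ * φ x ^ 2 = a₀ ^ 2 *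
        ((b₀ ^ 2 * (γ * (γ + 1) * tanh (b₀ * x) ^ 2 - γ) * SolitaryWave.sechPow γ b₀ x) ^ 2
          + (-(γ * b₀ * tanh (b₀ * x) * SolitaryWave.sechPow γ b₀ x)) ^ 2
          + b₀ ^ 4 * γ ^ 2 * (γ + 2) ^ 2 * SolitaryWave.sechPow γ b₀ x ^ 2) := by
      rw [d2, d1, hφ', hω']
      ring
    simp only [e]
    rw [integral_const_mul, SolitaryWave.integral_sechPow_energy hγ hb0 hγb, ← haγ, hτ',
      rpow_add ha0, rpow_two]
    ring
  · have c0 := hu.continuous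
    have hd : ContDiff ℝ 1 (deriv u) := by
      have h2 : ContDiff ℝ (1 + 1) u := by simpa [one_add_one_eq_two] using hu
      exact (contDiff_succ_iff_deriv.1 h2).2.2
    have hi : iteratedDeriv 2 u = deriv (deriv u) := by
      rw [iteratedDeriv_succ, iteratedDeriv_one]
    have c1 := hd.continuous
    have c2 : Continuous (iteratedDeriv 2 u) := hu.continuous_iteratedDeriv 2 le_rfl
    have key := SolitaryWave.mass_le_energy hγ hb0 hγb ha0 haγ
      (fun x => (hu.differentiable (by norm_num) x).hasDerivAt)
      (fun x => by rw [hi]; exact (hd.differentiable (by norm_num) x).hasDerivAt)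
      ((memLp_two_iff_integrable_sq_norm c0.aestronglyMeasurable).2 i0)
      ((memLp_two_iff_integrable_sq_norm c1.aestronglyMeasurable).2 i1)
      ((memLp_two_iff_integrable_sq_norm c2.aestronglyMeasurable).2 i2)
      (by rw [← hτ', ← hm, hp])
    rw [← hω', ← hp, hm] at key
    linarith
end
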